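/- arXiv:2512.01857 — 3 statements merged into one kernel-verified Lean document; each statement's English description precedes it below -/
import Mathlib

section
/- For every integer ℓ ≥ 2, every interrupted (ℓ+1)-ample (in the strengthened sense) (2ℓ+4, (2ℓ+3)ℓ+1)-constellation contains both T_{2,ℓ} ∪ ℓ·T_{1,ℓ} and T_{3,ℓ} ∪ ℓ·T_{1,ℓ} as induced minors. -/
open SimpleGraph

namespace Paper

variable {V W : Type*}

/-- `H` occurs as a subgraph of `G`: an injective map preserving adjacency. -/
def HasSubgraphCopy (G : SimpleGraph V) (H : SimpleGraph W) : Prop :=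
  ∃ f : W → V, Function.Injective f ∧ ∀ u v, H.Adj u v → G.Adj (f u) (f v)

/-- The complete bipartite graph `K_{t,t}`. -/
def Ktt (t : ℕ) : SimpleGraph (Fin t ⊕ Fin t) := completeBipartiteGraph (Fin t) (Fin t)

/-- The claw `K_{1,3}`. -/
def clawGraph : SimpleGraph (Fin 1 ⊕ Fin 3) := completeBipartiteGraph (Fin 1) (Fin 3)

/-- An induced minor model of `H` in `G`: pairwise disjoint nonempty connected branch
sets such that there is an edge between two branch sets iff the corresponding vertices
of `H` are adjacent. -/
def IsInducedMinorModel (H : SimpleGraph W) (G : SimpleGraph V) (M : W → Set V) : Prop :=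
  (∀ v, (M v).Nonempty) ∧
  (∀ v, (G.induce (M v)).Connected) ∧
  (Pairwise fun u v => Disjoint (M u) (M v)) ∧
  (∀ u v, u ≠ v → ((∃ a ∈ M u, ∃ b ∈ M v, G.Adj a b) ↔ H.Adj u v))

/-- `H` is an induced minor of `G`. -/
def InducedMinor (H : SimpleGraph W) (G : SimpleGraph V) : Prop :=
  ∃ M : W → Set V, IsInducedMinorModel H G M

/-- `G` admits a path-decomposition of width at most `w`. -/
def HasPWAtMost (G : SimpleGraph V) (w : ℕ) : Prop :=
  ∃ (m : ℕ) (B : Fin (m + 1) → Set V),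
    (∀ v, ∃ i, v ∈ B i) ∧
    (∀ u v, G.Adj u v → ∃ i, u ∈ B i ∧ v ∈ B i) ∧
    (∀ v, ∀ i j k : Fin (m + 1), i ≤ j → j ≤ k → v ∈ B i → v ∈ B k → v ∈ B j) ∧
    (∀ i, (B i).ncard ≤ w + 1)

/-- The pathwidth of `G`. -/
noncomputable def pathwidth (G : SimpleGraph V) : ℕ := sInf {w | HasPWAtMost G w}

/-- A class of (finite) graphs. -/
abbrev GraphClass := Set ((n : ℕ) × SimpleGraph (Fin n))

/-- A class of graphs is weakly sparse if it excludes some biclique `K_{t,t}` as a subgraph. -/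
def WeaklySparseClass (𝒞 : GraphClass) : Prop :=
  ∃ t : ℕ, 1 ≤ t ∧ ∀ G ∈ 𝒞, ¬ HasSubgraphCopy G.2 (Ktt t)

/-- A class of graphs has bounded pathwidth. -/
def BddPathwidth (𝒞 : GraphClass) : Prop :=
  ∃ w : ℕ, ∀ G ∈ 𝒞, pathwidth G.2 ≤ w

/-- A graph `H` is positive if every weakly sparse class of graphs excluding `H` as an
induced minor has bounded pathwidth. -/
def IsPositive (H : SimpleGraph W) : Prop :=
  ∀ 𝒞 : GraphClass, WeaklySparseClass 𝒞 → (∀ G ∈ 𝒞, ¬ InducedMinor H G.2) →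
    BddPathwidth 𝒞

/-- A graph `H` is negative if some weakly sparse class of graphs excluding `H` as an
induced minor has unbounded pathwidth. -/
def IsNegative (H : SimpleGraph W) : Prop :=
  ∃ 𝒞 : GraphClass, WeaklySparseClass 𝒞 ∧ (∀ G ∈ 𝒞, ¬ InducedMinor H G.2) ∧
    ¬ BddPathwidth 𝒞

/-- The closed neighborhood of a set of vertices. -/
def closedNbhd (G : SimpleGraph V) (S : Set V) : Set V :=
  {x | x ∈ S ∨ ∃ s ∈ S, G.Adj s x}

/-- The set `A` induces a claw in `G`. -/
def IsClawSet (G : SimpleGraph V) (A : Set V) : Prop :=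
  Nonempty ((G.induce A) ≃g clawGraph)

/-- `v` is the center of the claw induced by `A`. -/
def IsClawCenter (G : SimpleGraph V) (A : Set V) (v : V) : Prop :=
  v ∈ A ∧ ∀ u ∈ A, u ≠ v → G.Adj v u

/-- `v` is a leaf of the claw induced by `A`. -/
def IsClawLeaf (G : SimpleGraph V) (A : Set V) (v : V) : Prop :=
  v ∈ A ∧ ¬ IsClawCenter G A v

/-- `G` is (isomorphic to) a path graph. -/
def IsPathGraph (G : SimpleGraph V) : Prop :=
  ∃ n : ℕ, Nonempty (G ≃g pathGraph n)

/-- Any two vertices of `Y` and `Z` are joined by a walk avoiding `S`. -/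
def SameComponentAvoiding (G : SimpleGraph V) (Y Z S : Set V) : Prop :=
  ∀ u ∈ Y, ∀ v ∈ Z, ∃ p : G.Walk u v, ∀ x ∈ p.support, x ∉ S

/-- Some vertex of `Y` is joined to some vertex of `Z` by a walk avoiding `S`. -/
def ConnectsAvoiding (G : SimpleGraph V) (Y Z S : Set V) : Prop :=
  ∃ u ∈ Y, ∃ v ∈ Z, ∃ p : G.Walk u v, ∀ x ∈ p.support, x ∉ S

/-- There is an `A`–`B` path all of whose vertices avoid `S`. -/
def PathBetweenAvoiding (G : SimpleGraph V) (A B S : Set V) : Prop :=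
  ∃ a ∈ A, ∃ b ∈ B, ∃ p : G.Walk a b, p.IsPath ∧ ∀ x ∈ p.support, x ∉ S

/-- `a`, `b`, `c` form an asteroidal triple in `G`. -/
def AsteroidalTriple (G : SimpleGraph V) (a b c : V) : Prop :=
  a ≠ b ∧ a ≠ c ∧ b ≠ c ∧ ¬ G.Adj a b ∧ ¬ G.Adj a c ∧ ¬ G.Adj b c ∧
  ConnectsAvoiding G {a} {b} (closedNbhd G {c}) ∧
  ConnectsAvoiding G {a} {c} (closedNbhd G {b}) ∧
  ConnectsAvoiding G {b} {c} (closedNbhd G {a})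

/-- Selector for three sets. -/
def pick3 (A B C : Set V) : Fin 3 → Set V :=
  fun i => if i = 0 then A else if i = 1 then B else C

/-- The graph obtained from `G` by contracting each of the three disjoint sets
`A`, `B`, `C` into a single vertex. -/
def contractThree (G : SimpleGraph V) (A B C : Set V) :
    SimpleGraph ({x : V // x ∉ A ∪ B ∪ C} ⊕ Fin 3) :=
  SimpleGraph.fromRel (fun a b =>
    match a, b with
    | Sum.inl x, Sum.inl y => G.Adj x.1 y.1
    | Sum.inl x, Sum.inr i => ∃ s ∈ pick3 A B C i, G.Adj x.1 s
    | Sum.inr i, Sum.inr j => ∃ s ∈ pick3 A B C i, ∃ t ∈ pick3 A B C j, G.Adj s t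
    | Sum.inr _, Sum.inl _ => False)

/-- Three pairwise disjoint claws whose contraction into single vertices `a`, `b`, `c`
yields a forest in which `a`, `b`, `c` form an asteroidal triple. -/
def ThreeClawsConfig (F : SimpleGraph V) : Prop :=
  ∃ A B C : Set V, IsClawSet F A ∧ IsClawSet F B ∧ IsClawSet F C ∧
    Disjoint A B ∧ Disjoint A C ∧ Disjoint B C ∧
    (contractThree F A B C).IsAcyclic ∧
    AsteroidalTriple (contractThree F A B C) (Sum.inr 0) (Sum.inr 1) (Sum.inr 2)

/-- There is at most one edge of `G` between `S` and `T`. -/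
def AtMostOneCrossEdge (G : SimpleGraph V) (S T : Set V) : Prop :=
  ∀ x ∈ S, ∀ y ∈ T, G.Adj x y → ∀ x' ∈ S, ∀ y' ∈ T, G.Adj x' y' → x = x' ∧ y = y'

/-- Four pairwise disjoint claws `A`, `B`, `C`, `D`, an `A`–`B` path avoiding `N[C ∪ D]`,
a `C`–`D` path avoiding `N[A ∪ B]`, and at most one edge between `A ∪ B` and `C ∪ D`. -/
def FourClawsCore (H : SimpleGraph V) (A B C D : Set V) : Prop :=
  IsClawSet H A ∧ IsClawSet H B ∧ IsClawSet H C ∧ IsClawSet H D ∧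
  Disjoint A B ∧ Disjoint A C ∧ Disjoint A D ∧
  Disjoint B C ∧ Disjoint B D ∧ Disjoint C D ∧
  PathBetweenAvoiding H A B (closedNbhd H (C ∪ D)) ∧
  PathBetweenAvoiding H C D (closedNbhd H (A ∪ B)) ∧
  AtMostOneCrossEdge H (A ∪ B) (C ∪ D)

/-- Four-claw configuration in which the possible edge between `A ∪ B` and `C ∪ D` joins
a leaf of one of the claws `A`, `B` to a leaf of one of the claws `C`, `D`. -/
def NdsConfig (H : SimpleGraph V) (A B C D : Set V) : Prop :=
  FourClawsCore H A B C D ∧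
  ∀ x ∈ A ∪ B, ∀ y ∈ C ∪ D, H.Adj x y →
    (IsClawLeaf H A x ∨ IsClawLeaf H B x) ∧ (IsClawLeaf H C y ∨ IsClawLeaf H D y)

/-- Four-claw configuration in which the possible edge between `A ∪ B` and `C ∪ D` is not
incident to any of the four claw centers. -/
def NdsConfigCenters (H : SimpleGraph V) (A B C D : Set V) : Prop :=
  FourClawsCore H A B C D ∧
  ∀ x ∈ A ∪ B, ∀ y ∈ C ∪ D, H.Adj x y → ∀ c : V,
    (IsClawCenter H A c ∨ IsClawCenter H B c ∨ IsClawCenter H C c ∨ IsClawCenter H D c) →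
    x ≠ c ∧ y ≠ c

/-- Configuration of three sets as in the Pohoata–Davies grid lemma. -/
def NpdConfig (H : SimpleGraph V) (A B C : Set V) : Prop :=
  A.Nonempty ∧ B.Nonempty ∧ C.Nonempty ∧
  ∀ i : Fin 3,
    (∀ j : Fin 3, j ≠ i → Disjoint (closedNbhd H (pick3 A B C i)) (pick3 A B C j)) ∧
    (H.induce (pick3 A B C i)).Connected ∧
    ¬ IsPathGraph (H.induce (pick3 A B C i)) ∧
    ∀ j k : Fin 3, j ≠ i → k ≠ i →
      SameComponentAvoiding H (pick3 A B C j) (pick3 A B C k)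
        (closedNbhd H (pick3 A B C i))

/-- The `n × n` Pohoata–Davies grid: `n` paths on `n` vertices each (vertex `(j, i)` is
the `i`-th vertex of the `j`-th path), together with, for each `i`, a star vertex
adjacent to the `i`-th vertex of each path. -/
def pdGrid (n : ℕ) : SimpleGraph (Fin n × Fin n ⊕ Fin n) :=
  SimpleGraph.fromRel (fun a b =>
    match a, b with
    | Sum.inl p, Sum.inl q => p.1 = q.1 ∧ (p.2 : ℕ) + 1 = (q.2 : ℕ)
    | Sum.inl p, Sum.inr s => p.2 = s
    | _, _ => False)

/-- The death star of height `n`: its path has `2^n - 1` vertices, and the star vertex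
added at height `k+1` (for `k : Fin n`) is adjacent exactly to the path vertices `i`
with `i ≡ 2^(n-1-k) - 1 (mod 2^(n-k))`. -/
def deathStar (n : ℕ) : SimpleGraph (Fin (2 ^ n - 1) ⊕ Fin n) :=
  SimpleGraph.fromRel (fun a b =>
    match a, b with
    | Sum.inl i, Sum.inl j => (i : ℕ) + 1 = (j : ℕ)
    | Sum.inl i, Sum.inr k => (i : ℕ) % 2 ^ (n - (k : ℕ)) = 2 ^ (n - 1 - (k : ℕ)) - 1
    | _, _ => False)

/-- The tree `T_{1,ℓ}`: a root adjacent to the central vertex of each of `ℓ` disjoint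
paths on `2ℓ + 1` vertices. -/
def T1Graph (ℓ : ℕ) : SimpleGraph (Unit ⊕ Fin ℓ × Fin (2 * ℓ + 1)) :=
  SimpleGraph.fromRel (fun a b =>
    match a, b with
    | Sum.inl _, Sum.inr p => (p.2 : ℕ) = ℓ
    | Sum.inr p, Sum.inr q => p.1 = q.1 ∧ (p.2 : ℕ) + 1 = (q.2 : ℕ)
    | _, _ => False)

/-- Vertices of `T_{2,ℓ}` and `T_{3,ℓ}`: the root; the `ℓ` original leaves adjacent to
the root; the two subdivided paths `x_0, …, x_{ℓ+1}` and `y_0, …, y_{ℓ+1}` (with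
`x = x_0`, `y = y_0` the non-leaf children of the root); three attached `ℓ`-edge paths;
and `ℓ + 3` glued copies of `T_{1,ℓ}` (each consisting of `ℓ` paths on `2ℓ+1` vertices,
the root of the copy being identified with the glue site). -/
abbrev TVert (ℓ : ℕ) : Type :=
  Unit ⊕ Fin ℓ ⊕ (Fin 2 × Fin (ℓ + 2)) ⊕ (Fin 3 × Fin ℓ) ⊕
    (Fin (ℓ + 3) × Fin ℓ × Fin (2 * ℓ + 1))

/-- The `ℓ + 3` glue sites of a copy of `T_{1,ℓ}`: site `0` is `x`; site `1` is the far
end `x_{ℓ+1}`; site `2` is the far end `y_{ℓ+1}`; sites `3, …, ℓ+2` are the `ℓ` original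
leaves adjacent to the root. -/
def glueSite (ℓ : ℕ) (k : Fin (ℓ + 3)) : TVert ℓ :=
  if h : 3 ≤ (k : ℕ) then Sum.inr (Sum.inl ⟨(k : ℕ) - 3, by have := k.isLt; omega⟩)
  else if (k : ℕ) = 0 then Sum.inr (Sum.inr (Sum.inl (0, ⟨0, by omega⟩)))
  else if (k : ℕ) = 1 then Sum.inr (Sum.inr (Sum.inl (0, ⟨ℓ + 1, by omega⟩)))
  else Sum.inr (Sum.inr (Sum.inl (1, ⟨ℓ + 1, by omega⟩)))

/-- Attachment points of the three `ℓ`-edge paths: for both trees, paths `0` and `1` are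
attached at `x_ℓ` and `y_ℓ` (the parents of the two original leaves non-adjacent to the
root); path `2` is attached at the child `x_1` of `x` for `T_{2,ℓ}` (`three = false`)
and at `y = y_0` for `T_{3,ℓ}` (`three = true`). -/
def attachPt (ℓ : ℕ) (three : Bool) (p : Fin 3) : TVert ℓ :=
  if (p : ℕ) = 0 then Sum.inr (Sum.inr (Sum.inl (0, ⟨ℓ, by omega⟩)))
  else if (p : ℕ) = 1 then Sum.inr (Sum.inr (Sum.inl (1, ⟨ℓ, by omega⟩)))
  else if three then Sum.inr (Sum.inr (Sum.inl (1, ⟨0, by omega⟩)))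
  else Sum.inr (Sum.inr (Sum.inl (0, ⟨1, by omega⟩)))

/-- Base adjacency of `T_{2,ℓ}` (`three = false`) and `T_{3,ℓ}` (`three = true`). -/
def TAdj (ℓ : ℕ) (three : Bool) : TVert ℓ → TVert ℓ → Prop := fun a b =>
  match a, b with
  | Sum.inl _, Sum.inr (Sum.inl _) => True
  | Sum.inl _, Sum.inr (Sum.inr (Sum.inl p)) => (p.2 : ℕ) = 0
  | Sum.inr (Sum.inr (Sum.inl p)), Sum.inr (Sum.inr (Sum.inl q)) =>
      p.1 = q.1 ∧ (p.2 : ℕ) + 1 = (q.2 : ℕ)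
  | Sum.inr (Sum.inr (Sum.inr (Sum.inl p))), Sum.inr (Sum.inr (Sum.inr (Sum.inl q))) =>
      p.1 = q.1 ∧ (p.2 : ℕ) + 1 = (q.2 : ℕ)
  | Sum.inr (Sum.inr (Sum.inr (Sum.inr p))), Sum.inr (Sum.inr (Sum.inr (Sum.inr q))) =>
      p.1 = q.1 ∧ p.2.1 = q.2.1 ∧ (p.2.2 : ℕ) + 1 = (q.2.2 : ℕ)
  | x, Sum.inr (Sum.inr (Sum.inr (Sum.inl p))) => (p.2 : ℕ) = 0 ∧ x = attachPt ℓ three p.1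
  | x, Sum.inr (Sum.inr (Sum.inr (Sum.inr p))) => (p.2.2 : ℕ) = ℓ ∧ x = glueSite ℓ p.1
  | _, _ => False

/-- The tree `T_{2,ℓ}`. -/
def T2Graph (ℓ : ℕ) : SimpleGraph (TVert ℓ) := SimpleGraph.fromRel (TAdj ℓ false)

/-- The tree `T_{3,ℓ}`. -/
def T3Graph (ℓ : ℕ) : SimpleGraph (TVert ℓ) := SimpleGraph.fromRel (TAdj ℓ true)

/-- Disjoint union of two graphs. -/
def disjUnion (G : SimpleGraph V) (H : SimpleGraph W) : SimpleGraph (V ⊕ W) :=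
  SimpleGraph.fromRel (fun a b =>
    match a, b with
    | Sum.inl x, Sum.inl y => G.Adj x y
    | Sum.inr x, Sum.inr y => H.Adj x y
    | _, _ => False)

/-- Disjoint union of `m` copies of `G`. -/
def copies (m : ℕ) (G : SimpleGraph V) : SimpleGraph (Fin m × V) :=
  SimpleGraph.fromRel (fun a b => a.1 = b.1 ∧ G.Adj a.2 b.2)

/-- `T_{2,ℓ} ∪ ℓ·T_{1,ℓ}`. -/
def T2Union (ℓ : ℕ) : SimpleGraph (TVert ℓ ⊕ Fin ℓ × (Unit ⊕ Fin ℓ × Fin (2 * ℓ + 1))) :=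
  disjUnion (T2Graph ℓ) (copies ℓ (T1Graph ℓ))

/-- `T_{3,ℓ} ∪ ℓ·T_{1,ℓ}`. -/
def T3Union (ℓ : ℕ) : SimpleGraph (TVert ℓ ⊕ Fin ℓ × (Unit ⊕ Fin ℓ × Fin (2 * ℓ + 1))) :=
  disjUnion (T3Graph ℓ) (copies ℓ (T1Graph ℓ))

/-- Vertices of the infinite tree `T₁`. -/
abbrev T1InfVert : Type := Unit ⊕ ℕ ⊕ (ℕ × Fin 2 × ℕ)

/-- The infinite tree `T₁`: the root has countably many children, each child of the root
has exactly two children, and below these every vertex has exactly one child. -/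
def T1Inf : SimpleGraph T1InfVert :=
  SimpleGraph.fromRel (fun a b =>
    match a, b with
    | Sum.inl _, Sum.inr (Sum.inl _) => True
    | Sum.inr (Sum.inl i), Sum.inr (Sum.inr p) => i = p.1 ∧ p.2.2 = 0
    | Sum.inr (Sum.inr p), Sum.inr (Sum.inr q) =>
        p.1 = q.1 ∧ p.2.1 = q.2.1 ∧ p.2.2 + 1 = q.2.2
    | _, _ => False)

/-- A (finite) tree belongs to `𝒯₁` iff it is isomorphic to a connected induced
subgraph of `T₁`. -/
def MemT1Class (T : SimpleGraph W) : Prop :=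
  ∃ S : Set T1InfVert, (T1Inf.induce S).Connected ∧ Nonempty (T ≃g T1Inf.induce S)

/-- In a tree `T` rooted at `r`, `u` is a (not necessarily strict) ancestor of `v`. -/
def IsAncestor (T : SimpleGraph V) (r u v : V) : Prop :=
  ∃ p : T.Walk r v, p.IsPath ∧ u ∈ p.support

/-- The vertex set of the subtree of `T` (rooted at `r`) rooted at `x`. -/
def rootedSubtree (T : SimpleGraph V) (r x : V) : Set V := {v | IsAncestor T r x v}

/-- The set of vertices `x` whose rooted subtree contains a claw while no subtree rooted
at a strict descendant of `x` contains a claw. -/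
def clawMinimalSet (T : SimpleGraph V) (r : V) : Set V :=
  {x | (∃ A ⊆ rootedSubtree T r x, IsClawSet T A) ∧
    ∀ y, IsAncestor T r x y → y ≠ x → ¬ ∃ A ⊆ rootedSubtree T r y, IsClawSet T A}

/-- `z` is the least common ancestor of `x` and `y` in the tree `T` rooted at `r`. -/
def IsLCA (T : SimpleGraph V) (r x y z : V) : Prop :=
  IsAncestor T r z x ∧ IsAncestor T r z y ∧
    ∀ w, IsAncestor T r w x → IsAncestor T r w y → IsAncestor T r w z

/-- The set of least common ancestors of distinct pairs of `X`. -/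
def lcaSet (T : SimpleGraph V) (r : V) (X : Set V) : Set V :=
  {z | ∃ x ∈ X, ∃ y ∈ X, x ≠ y ∧ IsLCA T r x y z}

/-- `(G, S, L)` is a constellation: `S` is independent, the components of `G - S` are
exactly the paths of `L`, and every vertex of `S` has a neighbor on every path of `L`. -/
structure IsConstellation (G : SimpleGraph V) (S : Set V) (L : Set (Set V)) : Prop where
  indep : S.Pairwise fun x y => ¬ G.Adj x y
  pathsOffS : ∀ P ∈ L, Disjoint P S
  cover : ∀ v, v ∉ S → ∃ P ∈ L, v ∈ P
  pathsDisj : L.Pairwise fun P Q => Disjoint P Q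
  pathsNonempty : ∀ P ∈ L, P.Nonempty
  pathsArePaths : ∀ P ∈ L, IsPathGraph (G.induce P)
  pathsSep : ∀ P ∈ L, ∀ Q ∈ L, P ≠ Q → ∀ u ∈ P, ∀ v ∈ Q, ¬ G.Adj u v
  dominates : ∀ s ∈ S, ∀ P ∈ L, ∃ v ∈ P, G.Adj s v

/-- `(S, L)` has sizes `(s, p)`. -/
def IsSPConst (S : Set V) (L : Set (Set V)) (s p : ℕ) : Prop :=
  S.Finite ∧ S.ncard = s ∧ L.Finite ∧ L.ncard = p

/-- A `C`-route: a nontrivial path whose endpoints are in `S` and whose internal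
vertices avoid `S`. -/
def IsRoute (G : SimpleGraph V) (S : Set V) (x y : V) (p : G.Walk x y) : Prop :=
  x ∈ S ∧ y ∈ S ∧ p.IsPath ∧ 0 < p.length ∧
    ∀ v ∈ p.support, v ≠ x → v ≠ y → v ∉ S

/-- `d`-ample: no route with at most `d + 1` edges. -/
def IsAmple (G : SimpleGraph V) (S : Set V) (d : ℕ) : Prop :=
  ∀ (x y : V) (p : G.Walk x y), IsRoute G S x y p → d + 1 < p.length

/-- `e` is an endpoint of the path induced on `P`. -/
def IsPathEndpoint (G : SimpleGraph V) (P : Set V) (e : V) : Prop :=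
  e ∈ P ∧ {v | v ∈ P ∧ G.Adj e v}.ncard ≤ 1

/-- `d`-ample in the strengthened sense: additionally no vertex of `S` has a neighbor on
a path `P ∈ L` at distance (in `P`) less than `d` from an endpoint of `P`. -/
def IsAmpleStrong (G : SimpleGraph V) (S : Set V) (L : Set (Set V)) (d : ℕ) : Prop :=
  IsAmple G S d ∧
  ∀ s ∈ S, ∀ P ∈ L, ∀ (v : V) (hv : v ∈ P), G.Adj s v →
    ∀ (e : V) (he : e ∈ P), IsPathEndpoint G P e →
      d ≤ (G.induce P).dist ⟨v, hv⟩ ⟨e, he⟩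

/-- `r` is a strict total order on `S`. -/
def StrictTotalOrderOn (S : Set V) (r : V → V → Prop) : Prop :=
  (∀ x ∈ S, ¬ r x x) ∧
  (∀ x ∈ S, ∀ y ∈ S, ∀ z ∈ S, r x y → r y z → r x z) ∧
  (∀ x ∈ S, ∀ y ∈ S, x ≠ y → r x y ∨ r y x)

/-- Interrupted constellation: some total order on `S` such that for every `x ≺ y ≺ z`,
every route between `x` and `y` is adjacent to `z`. -/
def IsInterrupted (G : SimpleGraph V) (S : Set V) : Prop :=
  ∃ r : V → V → Prop, StrictTotalOrderOn S r ∧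
    ∀ x ∈ S, ∀ y ∈ S, ∀ z ∈ S, r x y → r y z →
      ∀ p : G.Walk x y, IsRoute G S x y p → ∃ v ∈ p.support, G.Adj z v

/-- `q`-zigzagged constellation: some total order on `S` such that for every route
between `x` and `y`, fewer than `q` vertices strictly between `x` and `y` have no
neighbor on the route. -/
def IsZigzagged (G : SimpleGraph V) (S : Set V) (q : ℕ) : Prop :=
  ∃ r : V → V → Prop, StrictTotalOrderOn S r ∧
    ∀ x ∈ S, ∀ y ∈ S, ∀ p : G.Walk x y, IsRoute G S x y p →
      {z | z ∈ S ∧ ((r x z ∧ r z y) ∨ (r y z ∧ r z x)) ∧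
        ∀ v ∈ p.support, ¬ G.Adj z v}.ncard < q

/-- Lift a subset of `V` to a subset of the subtype `↥U`. -/
def liftToSub (U : Set V) (T : Set V) : Set ↥U := {v : ↥U | (v : V) ∈ T}

/-- The graph `H'` obtained from `H` by adding a disjoint path on `2ℓ+1` vertices and
joining `u` to the center of this path. -/
def addPendantPath (H : SimpleGraph W) (u : W) (ℓ : ℕ) :
    SimpleGraph (W ⊕ Fin (2 * ℓ + 1)) :=
  SimpleGraph.fromRel (fun a b =>
    match a, b with
    | Sum.inl v, Sum.inl w => H.Adj v w
    | Sum.inl v, Sum.inr i => v = u ∧ (i : ℕ) = ℓ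
    | Sum.inr i, Sum.inr j => (i : ℕ) + 1 = (j : ℕ)
    | Sum.inr _, Sum.inl _ => False)

/-! ### Combinatorial part -/

inductive CV : Type
  | root : CV
  | leaf (i : ℕ) : CV
  | x (j : ℕ) : CV
  | y (j : ℕ) : CV
  | pd (p j : ℕ) : CV
  | arm (u k j : ℕ) : CV
  | free (i : ℕ) : CV

def csite (ℓ u : ℕ) : CV :=
  if u = 0 then .x 0 else if u = 1 then .x (ℓ + 1) else if u = 2 then .y (ℓ + 1)
  else if u < ℓ + 3 then .leaf (u - 3) else .free (u - (ℓ + 3))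

def catt (ℓ : ℕ) (three : Bool) (p : ℕ) : CV :=
  if p = 0 then .x ℓ else if p = 1 then .y ℓ else if three then .y 0 else .x 1

def BA (ℓ : ℕ) (three : Bool) (a b : CV) : Prop :=
  match a, b with
  | .root, .leaf _ => True
  | .root, .x j => j = 0
  | .root, .y j => j = 0
  | .x i, .x j => i + 1 = j
  | .y i, .y j => i + 1 = j
  | .pd p i, .pd q j => p = q ∧ i + 1 = j
  | .arm u k i, .arm u' k' j => u = u' ∧ k = k' ∧ i + 1 = j
  | w, .pd p j => j = 0 ∧ w = catt ℓ three p
  | w, .arm u _ j => j = ℓ ∧ w = csite ℓ u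
  | _, _ => False

def CValid (ℓ : ℕ) : CV → Prop
  | .root => True
  | .leaf i => i < ℓ
  | .x j => j < ℓ + 2
  | .y j => j < ℓ + 2
  | .pd p j => p < 3 ∧ j < ℓ
  | .arm u k j => u < 2 * ℓ + 3 ∧ k < ℓ ∧ j < 2 * ℓ + 1
  | .free i => i < ℓ

def IsArm : CV → Prop
  | .arm _ _ _ => True
  | _ => False

/-- adjacency pattern of the star vertices on a path -/
structure Wd (ℓ m : ℕ) (A : Fin (2 * ℓ + 4) → ℕ → Prop) : Prop where
  lt : ∀ s i, A s i → ℓ + 1 ≤ i ∧ i + ℓ + 1 < m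
  far : ∀ s t i j, A s i → A t j → s ≠ t → i ≤ j → i + ℓ + 1 ≤ j
  intr : ∀ s t u i j, A s i → A t j → s ≠ t → s < u → t < u → i ≤ j → ∃ k, i < k ∧ k < j ∧ A u k
  occ : ∀ s, ∃ i, A s i

def COwn (ℓ : ℕ) (three : Bool) (hs : ℕ → Fin (2 * ℓ + 4)) (w : CV) (s : Fin (2 * ℓ + 4)) : Prop :=
  (∃ u < 2 * ℓ + 3, w = csite ℓ u ∧ s = hs u) ∨ (three = true ∧ w = .root ∧ s = Fin.last _)

structure CoreLab (ℓ : ℕ) (three : Bool) (m : ℕ) (A : Fin (2 * ℓ + 4) → ℕ → Prop)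
    (hs : ℕ → Fin (2 * ℓ + 4)) (Lab : ℕ → CV → Prop) : Prop where
  inj : ∀ u v, u < 2 * ℓ + 3 → v < 2 * ℓ + 3 → hs u = hs v → u = v
  top : three = true → ∀ u < 2 * ℓ + 3, hs u ≠ Fin.last _
  dom : ∀ i w, Lab i w → i < m
  fn : ∀ i w w', Lab i w → Lab i w' → w = w'
  core : ∀ i w, Lab i w → ¬ IsArm w
  ne : ∀ w, CValid ℓ w → ¬ IsArm w → (∃ s, COwn ℓ three hs w s) ∨ ∃ i, Lab i w
  conv : ∀ i j k w, Lab i w → Lab k w → i ≤ j → j ≤ k → Lab j w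
  own : ∀ i w s, Lab i w → COwn ℓ three hs w s → ∃ j, Lab j w ∧ A s j
  step : ∀ i u v, Lab i u → Lab (i + 1) v → u = v ∨ BA ℓ three u v ∨ BA ℓ three v u
  star : ∀ i u w s, Lab i u → COwn ℓ three hs w s → A s i →
    u = w ∨ BA ℓ three u w ∨ BA ℓ three w u
  real : ∀ u v, CValid ℓ u → CValid ℓ v → ¬ IsArm v → BA ℓ three u v →
    (∃ i, Lab i u ∧ Lab (i + 1) v) ∨ (∃ i, Lab i v ∧ Lab (i + 1) u) ∨
    (∃ i s, Lab i u ∧ COwn ℓ three hs v s ∧ A s i) ∨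
    (∃ i s, Lab i v ∧ COwn ℓ three hs u s ∧ A s i)

theorem BA_cases {ℓ : ℕ} {three : Bool} {u v : CV} (h : BA ℓ three u v) (hv : ¬ IsArm v) :
    (u = .root ∧ ∃ i, v = .leaf i) ∨ (u = .root ∧ v = .x 0) ∨ (u = .root ∧ v = .y 0) ∨
    (∃ j, u = .x j ∧ v = .x (j + 1)) ∨ (∃ j, u = .y j ∧ v = .y (j + 1)) ∨
    (∃ p j, u = .pd p j ∧ v = .pd p (j + 1)) ∨
    (∃ p, u = catt ℓ three p ∧ v = .pd p 0) := by
  cases u <;> cases v <;> simp_all [BA, IsArm]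

theorem exists_min {Q : ℕ → Prop} (h : ∃ x, Q x) : ∃ x, Q x ∧ ∀ y, Q y → x ≤ y := by
  classical
  exact ⟨Nat.find h, Nat.find_spec h, fun y hy => Nat.find_min' h hy⟩

theorem exists_max {Q : ℕ → Prop} (m : ℕ) (hb : ∀ y, Q y → y ≤ m) (h : ∃ x, Q x) :
    ∃ x, Q x ∧ ∀ y, Q y → y ≤ x := by
  classical
  obtain ⟨x, hx⟩ := h
  exact ⟨Nat.findGreatest Q m, Nat.findGreatest_spec (hb x hx) hx,
    fun y hy => Nat.le_findGreatest (hb y hy) hy⟩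

theorem Wd.leftrun {ℓ m : ℕ} {A : Fin (2 * ℓ + 4) → ℕ → Prop} (W : Wd ℓ m A)
    {s : Fin (2 * ℓ + 4)} {p : ℕ} (h : A s p) :
    ∃ lo, lo ≤ p ∧ ℓ < lo ∧ A s lo ∧ (∀ i t, lo ≤ i + ℓ → i < lo → ¬ A t i) ∧
      (∀ i t, lo ≤ i → i ≤ p → A t i → t = s) := by
  have hu : ∀ i j t, A s i → A t j → i ≤ j + ℓ → j ≤ i + ℓ → t = s := by
    intro i j t hi hj h1 h2
    by_contra hne
    rcases le_total i j with hij | hij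
    · have := W.far s t i j hi hj (Ne.symm hne) hij; omega
    · have := W.far t s j i hj hi hne hij; omega
  obtain ⟨lo, ⟨h1, h2, h3⟩, h4⟩ := exists_min
    (Q := fun lo => lo ≤ p ∧ A s lo ∧ ∀ i t, lo ≤ i → i ≤ p → A t i → t = s)
    ⟨p, le_rfl, h, fun i t hi hi' ht => hu p i t h ht (by omega) (by omega)⟩
  refine ⟨lo, h1, (W.lt s lo h2).1, h2, ?_, h3⟩
  intro i t hi1 hi2 ht
  have hts := hu lo i t h2 ht (by omega) (by omega)
  subst hts
  have := h4 i ⟨by omega, ht, ?_⟩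
  · omega
  · intro i' t' h5 h6 h7
    rcases le_or_gt lo i' with h8 | h8
    · exact h3 _ _ h8 h6 h7
    · exact hu lo i' t' h2 h7 (by omega) (by omega)

theorem Wd.rightrun {ℓ m : ℕ} {A : Fin (2 * ℓ + 4) → ℕ → Prop} (W : Wd ℓ m A)
    {s : Fin (2 * ℓ + 4)} {p : ℕ} (h : A s p) :
    ∃ hi, p ≤ hi ∧ hi + ℓ + 1 < m ∧ A s hi ∧ (∀ i t, i ≤ hi + ℓ → hi < i → ¬ A t i) ∧
      (∀ i t, p ≤ i → i ≤ hi → A t i → t = s) := by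
  have hu : ∀ i j t, A s i → A t j → i ≤ j + ℓ → j ≤ i + ℓ → t = s := by
    intro i j t hi hj h1 h2
    by_contra hne
    rcases le_total i j with hij | hij
    · have := W.far s t i j hi hj (Ne.symm hne) hij; omega
    · have := W.far t s j i hj hi hne hij; omega
  obtain ⟨hi, ⟨h1, h2, h3⟩, h4⟩ := exists_max
    (Q := fun hi => p ≤ hi ∧ A s hi ∧ ∀ i t, p ≤ i → i ≤ hi → A t i → t = s) m
    (fun y hy => by have := (W.lt s y hy.2.1).2; omega)
    ⟨p, le_rfl, h, fun i t hi hi' ht => hu p i t h ht (by omega) (by omega)⟩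
  refine ⟨hi, h1, (W.lt s hi h2).2, h2, ?_, h3⟩
  intro i t hi1 hi2 ht
  have hts := hu hi i t h2 ht (by omega) (by omega)
  subst hts
  have := h4 i ⟨by omega, ht, ?_⟩
  · omega
  · intro i' t' h5 h6 h7
    rcases le_or_gt i' hi with h8 | h8
    · exact h3 _ _ h5 h8 h7
    · exact hu hi i' t' h2 h7 (by omega) (by omega)

theorem csite_cases {ℓ u : ℕ} (hu : u < 2 * ℓ + 3) :
    (u = 0 ∧ csite ℓ u = .x 0) ∨ (u = 1 ∧ csite ℓ u = .x (ℓ + 1)) ∨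
    (u = 2 ∧ csite ℓ u = .y (ℓ + 1)) ∨ (∃ i < ℓ, u = i + 3 ∧ csite ℓ u = .leaf i) ∨
    (∃ i < ℓ, u = ℓ + 3 + i ∧ csite ℓ u = .free i) := by
  unfold csite
  by_cases h0 : u = 0
  · simp [h0]
  by_cases h1 : u = 1
  · simp [h1]
  by_cases h2 : u = 2
  · simp [h2]
  by_cases h3 : u < ℓ + 3
  · right; right; right; left
    exact ⟨u - 3, by omega, by omega, by simp [h0, h1, h2, h3]⟩
  · right; right; right; right
    exact ⟨u - (ℓ + 3), by omega, by omega, by simp [h0, h1, h2, h3]⟩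

theorem csite_inj {ℓ u v : ℕ} (hu : u < 2 * ℓ + 3) (hv : v < 2 * ℓ + 3)
    (h : csite ℓ u = csite ℓ v) : u = v := by
  rcases csite_cases hu with ⟨a, b⟩ | ⟨a, b⟩ | ⟨a, b⟩ | ⟨i, hi, a, b⟩ | ⟨i, hi, a, b⟩ <;>
  rcases csite_cases hv with ⟨a', b'⟩ | ⟨a', b'⟩ | ⟨a', b'⟩ | ⟨i', hi', a', b'⟩ | ⟨i', hi', a', b'⟩ <;>
  rw [b, b'] at h <;> simp at h <;> omega

theorem csite_leaf {ℓ i : ℕ} (h : i < ℓ) : csite ℓ (i + 3) = .leaf i := by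
  simp [csite, h]

theorem csite_free {ℓ i : ℕ} : csite ℓ (ℓ + 3 + i) = .free i := by
  unfold csite
  rw [if_neg (by omega), if_neg (by omega), if_neg (by omega), if_neg (by omega)]
  congr 1; omega

theorem csite_valid {ℓ u : ℕ} (hu : u < 2 * ℓ + 3) :
    CValid ℓ (csite ℓ u) ∧ ¬ IsArm (csite ℓ u) ∧ csite ℓ u ≠ .root := by
  rcases csite_cases hu with ⟨a, b⟩ | ⟨a, b⟩ | ⟨a, b⟩ | ⟨i, hi, a, b⟩ | ⟨i, hi, a, b⟩ <;>
  rw [b] <;> simp [CValid, IsArm] <;> omega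

theorem exists_free (n : ℕ) {α : Type*} [DecidableEq α] (D : Finset α) (hD : n ≤ D.card) (d : α) :
    ∃ fr : ℕ → α, (∀ i < n, fr i ∈ D) ∧ ∀ i j, i < n → j < n → fr i = fr j → i = j := by
  classical
  let e := D.equivFin.symm
  refine ⟨fun i => if h : i < n then (e ⟨i, by omega⟩ : α) else d, ?_, ?_⟩
  · intro i hi; simp [hi]
  · intro i j hi hj h
    simp only [hi, hj, dif_pos] at h
    have := e.injective (Subtype.ext h)
    simpa using this

set_option maxHeartbeats 4000000 in
theorem core2 {ℓ m : ℕ} (hℓ : 2 ≤ ℓ) {A : Fin (2 * ℓ + 4) → ℕ → Prop} (W : Wd ℓ m A)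
    (c e b : Fin (2 * ℓ + 4)) (p q z : ℕ) (hc : A c p) (he : A e q) (hb : A b z)
    (hpq : p < q) (hqz : q < z) (hce : c ≠ e) (hbc : b ≠ c) (hbe : b ≠ e)
    (hcK : c.val ≤ ℓ + 2) (heK : e.val ≤ ℓ + 2) (hbK : b.val ≤ ℓ + 2)
    (hmid : ∀ i t, p < i → i < q → A t i → ℓ + 2 < t.val) :
    ∃ hs Lab, CoreLab ℓ false m A hs Lab := by
  classical
  set T : Fin (2 * ℓ + 4) := Fin.last _ with hT
  have hTv : T.val = 2 * ℓ + 3 := rfl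
  have hltT : ∀ s : Fin (2 * ℓ + 4), s ≠ T → s < T := fun s hs => lt_of_le_of_ne (Fin.le_last s) hs
  have hcT : c ≠ T := by intro h; rw [h] at hcK; omega
  have heT : e ≠ T := by intro h; rw [h] at heK; omega
  have hbT : b ≠ T := by intro h; rw [h] at hbK; omega
  -- free letters
  obtain ⟨fr, hfr1, hfr2⟩ := exists_free ℓ
    (((Finset.univ : Finset (Fin (2 * ℓ + 4))).filter (fun s => s.val < ℓ + 3)) \ {c, e, b}) (by
      have h1 : ((Finset.univ : Finset (Fin (2 * ℓ + 4))).filter (fun s => s.val < ℓ + 3)).card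
          = ℓ + 3 := by
        rw [Fin.card_filter_val_lt]; omega
      have h2 := Finset.le_card_sdiff ({c, e, b} : Finset (Fin (2 * ℓ + 4)))
        ((Finset.univ : Finset (Fin (2 * ℓ + 4))).filter (fun s => s.val < ℓ + 3))
      have h3 := Finset.card_le_three (a := c) (b := e) (c := b)
      omega) c
  have hfr : ∀ i < ℓ, (fr i).val < ℓ + 3 ∧ fr i ≠ c ∧ fr i ≠ e ∧ fr i ≠ b := by
    intro i hi; simpa using hfr1 i hi
  let lf : ℕ → Fin (2 * ℓ + 4) := fun i => ⟨2 * ℓ + 2 - i, by omega⟩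
  let hs : ℕ → Fin (2 * ℓ + 4) := fun u => if u = 0 then T else if u = 1 then b else
    if u = 2 then c else if u < ℓ + 3 then lf (u - 3) else fr (u - (ℓ + 3))
  have hs0 : hs 0 = T := by simp [hs]
  have hs1 : hs 1 = b := by simp [hs]
  have hs2 : hs 2 = c := by simp [hs]
  have hs3 : ∀ i < ℓ, hs (i + 3) = lf i := by intro i hi; simp [hs, hi]
  have hs4 : ∀ i, hs (ℓ + 3 + i) = fr i := by
    intro i; simp only [hs]
    rw [if_neg (by omega), if_neg (by omega), if_neg (by omega), if_neg (by omega)]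
    congr 1; omega
  have hinj : ∀ u v, u < 2 * ℓ + 3 → v < 2 * ℓ + 3 → hs u = hs v → u = v := by
    have key : ∀ u < 2 * ℓ + 3, (u = 0 ∧ hs u = T) ∨ (u = 1 ∧ hs u = b) ∨ (u = 2 ∧ hs u = c) ∨
        (∃ i < ℓ, u = i + 3 ∧ hs u = lf i) ∨ (∃ i < ℓ, u = ℓ + 3 + i ∧ hs u = fr i) := by
      intro u hu
      rcases csite_cases hu with ⟨rfl, _⟩ | ⟨rfl, _⟩ | ⟨rfl, _⟩ | ⟨i, hi, rfl, _⟩ | ⟨i, hi, rfl, _⟩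
      · simp [hs0]
      · simp [hs1]
      · simp [hs2]
      · right; right; right; left; exact ⟨i, hi, rfl, hs3 i hi⟩
      · right; right; right; right; exact ⟨i, hi, rfl, hs4 i⟩
    have lfv : ∀ i, (lf i).val = 2 * ℓ + 2 - i := fun i => rfl
    intro u v hu hv h
    rcases key u hu with ⟨a, h1⟩ | ⟨a, h1⟩ | ⟨a, h1⟩ | ⟨i, hi, a, h1⟩ | ⟨i, hi, a, h1⟩ <;>
    rcases key v hv with ⟨a', h1'⟩ | ⟨a', h1'⟩ | ⟨a', h1'⟩ | ⟨i', hi', a', h1'⟩ | ⟨i', hi', a', h1'⟩ <;>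
    rw [h1, h1'] at h <;> have hv := congrArg Fin.val h <;>
    first
    | (exfalso; first
        | exact hbc h
        | exact hbc h.symm
        | exact (hfr _ ‹_›).2.1 h
        | exact (hfr _ ‹_›).2.1 h.symm
        | exact (hfr _ ‹_›).2.2.2 h
        | exact (hfr _ ‹_›).2.2.2 h.symm)
    | (have := hfr2 _ _ hi hi' h; omega)
    | (have h7 := hfr _ hi; have h8 := lfv i'; omega)
    | (have h7 := hfr _ hi'; have h8 := lfv i; omega)
    | (have h8 := lfv i'; have h9 := lfv i; omega)
    | (have h8 := lfv i'; omega)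
    | (have h8 := lfv i; omega)
    | (have h7 := hfr _ hi; omega)
    | (have h7 := hfr _ hi'; omega)
    | omega
  -- positions
  obtain ⟨q1, ⟨hq1a, hq1b, hq1c⟩, hq1m⟩ := exists_min (Q := fun i => p < i ∧ i < q ∧ A T i) (by
    obtain ⟨k, h1, h2, h3⟩ := W.intr c e T p q hc he hce (hltT _ hcT) (hltT _ heT) hpq.le
    exact ⟨k, h1, h2, h3⟩)
  obtain ⟨r, ⟨hra, hrb, hrc⟩, hrm⟩ := exists_max (Q := fun i => p < i ∧ i < q ∧ A T i) q
    (fun y hy => hy.2.1.le) ⟨q1, hq1a, hq1b, hq1c⟩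
  have hqr : q1 ≤ r := hq1m r ⟨hra, hrb, hrc⟩
  have hgapA : ∀ i t, p < i → i < q1 → ¬ A t i := by
    intro i t h1 h2 ht
    have hK := hmid i t h1 (by omega) ht
    by_cases htT : t = T
    · subst htT; have := hq1m i ⟨h1, by omega, ht⟩; omega
    · obtain ⟨k, h3, h4, h5⟩ := W.intr c t T p i hc ht (by rintro rfl; omega) (hltT _ hcT)
        (hltT _ htT) h1.le
      have := hq1m k ⟨h3, by omega, h5⟩; omega
  have hleaf : ∀ t : Fin (2 * ℓ + 4), ℓ + 2 < t.val → ∃ i, q1 ≤ i ∧ i ≤ r ∧ A t i := by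
    intro t ht
    by_cases htT : t = T
    · subst htT; exact ⟨q1, le_rfl, hqr, hq1c⟩
    · obtain ⟨i, h1, h2, h3⟩ := W.intr c e t p q hc he hce (Fin.lt_def.2 (by omega))
        (Fin.lt_def.2 (by omega)) hpq.le
      refine ⟨i, ?_, ?_, h3⟩
      · obtain ⟨k, h4, h5, h6⟩ := W.intr c t T p i hc h3 (by rintro rfl; omega) (hltT _ hcT)
          (hltT _ htT) h1.le
        have := hq1m k ⟨h4, by omega, h6⟩; omega
      · obtain ⟨k, h4, h5, h6⟩ := W.intr t e T i q h3 he (by rintro rfl; omega) (hltT _ htT)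
          (hltT _ heT) h2.le
        have := hrm k ⟨by omega, by omega, h6⟩; omega
  have hpq1 := W.far c T p q1 hc hq1c hcT hq1a.le
  obtain ⟨z1, ⟨hz1a, hz1b⟩, hz1m⟩ := exists_min (Q := fun i => q < i ∧ A b i) ⟨z, hqz, hb⟩
  obtain ⟨p2, ⟨hp2a, hp2b, hp2c⟩, hp2m⟩ := exists_max (Q := fun i => q < i ∧ i < z1 ∧ A T i) z1
    (fun y hy => hy.2.1.le) (by
      obtain ⟨k, h1, h2, h3⟩ := W.intr e b T q z1 he hz1b (Ne.symm hbe) (hltT _ heT) (hltT _ hbT)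
        hz1a.le
      exact ⟨k, h1, h2, h3⟩)
  have hgapB : ∀ i t, p2 < i → i < z1 → ¬ A t i := by
    intro i t h1 h2 ht
    by_cases htT : t = T
    · subst htT; have := hp2m i ⟨by omega, by omega, ht⟩; omega
    · by_cases htb : t = b
      · subst htb; have := hz1m i ⟨by omega, ht⟩; omega
      · obtain ⟨k, h3, h4, h5⟩ := W.intr t b T i z1 ht hz1b htb (hltT _ htT)
          (hltT _ hbT) h2.le
        have := hp2m k ⟨by omega, by omega, h5⟩; omega
  have hpz := W.far T b p2 z1 hp2c hz1b (Ne.symm hbT) hp2b.le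
  obtain ⟨lo, hlo1, hlo2, hlo3, hlo4, hlo5⟩ := W.leftrun hc
  obtain ⟨lo', hl1, hl2, hl3, hl4, hl5⟩ := W.leftrun hp2c
  obtain ⟨hi', hh1, hh2, hh3, hh4, hh5⟩ := W.rightrun hz1b
  have hsep : q + ℓ < lo' := by
    by_contra hcon
    rcases lt_or_ge q lo' with h | h
    · exact hl4 q e (by omega) h he
    · exact heT (hl5 q e h hp2a.le he)
  let Lab : ℕ → CV → Prop := fun i w =>
    (lo ≤ i + ℓ ∧ i < lo ∧ w = .pd 1 (lo - 1 - i)) ∨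
    (lo ≤ i ∧ i < q1 ∧ w = .y (min (q1 - 1 - i) ℓ)) ∨
    (q1 ≤ i ∧ i ≤ r ∧ w = .root) ∨
    (lo' ≤ i + ℓ ∧ i < lo' ∧ w = .pd 2 (lo' - 1 - i)) ∨
    (lo' ≤ i ∧ i ≤ hi' ∧ w = .x (max 1 (min (i - (z1 - ℓ)) ℓ))) ∨
    (hi' < i ∧ i ≤ hi' + ℓ ∧ w = .pd 0 (i - hi' - 1))
  have hown : ∀ u < 2 * ℓ + 3, COwn ℓ false hs (csite ℓ u) (hs u) := fun u hu =>
    Or.inl ⟨u, hu, rfl, rfl⟩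
  have cs0 : csite ℓ 0 = .x 0 := by simp [csite]
  have cs1 : csite ℓ 1 = .x (ℓ + 1) := by simp [csite]
  have cs2 : csite ℓ 2 = .y (ℓ + 1) := by simp [csite]
  have ow0 : COwn ℓ false hs (.x 0) T := by have := hown 0 (by omega); rwa [cs0, hs0] at this
  have ow1 : COwn ℓ false hs (.x (ℓ + 1)) b := by have := hown 1 (by omega); rwa [cs1, hs1] at this
  have ow2 : COwn ℓ false hs (.y (ℓ + 1)) c := by have := hown 2 (by omega); rwa [cs2, hs2] at this
  have ow3 : ∀ i < ℓ, COwn ℓ false hs (.leaf i) (lf i) := by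
    intro i hi; have := hown (i + 3) (by omega); rwa [csite_leaf hi, hs3 i hi] at this
  have ow4 : ∀ i < ℓ, COwn ℓ false hs (.free i) (fr i) := by
    intro i hi; have := hown (ℓ + 3 + i) (by omega); rwa [csite_free, hs4 i] at this
  refine ⟨hs, Lab, ⟨hinj, by simp, ?_, ?_, ?_, ?_, ?_, ?_, ?_, ?_, ?_⟩⟩
  · rintro i w (⟨h1, h2, rfl⟩ | ⟨h1, h2, rfl⟩ | ⟨h1, h2, rfl⟩ | ⟨h1, h2, rfl⟩ | ⟨h1, h2, rfl⟩ | ⟨h1, h2, rfl⟩) <;> omega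
  · rintro i w w' (⟨h1, h2, rfl⟩ | ⟨h1, h2, rfl⟩ | ⟨h1, h2, rfl⟩ | ⟨h1, h2, rfl⟩ | ⟨h1, h2, rfl⟩ | ⟨h1, h2, rfl⟩)
      (⟨h1', h2', rfl⟩ | ⟨h1', h2', rfl⟩ | ⟨h1', h2', rfl⟩ | ⟨h1', h2', rfl⟩ | ⟨h1', h2', rfl⟩ | ⟨h1', h2', rfl⟩) <;>
    first | rfl | omega
  · rintro i w (⟨h1, h2, rfl⟩ | ⟨h1, h2, rfl⟩ | ⟨h1, h2, rfl⟩ | ⟨h1, h2, rfl⟩ | ⟨h1, h2, rfl⟩ | ⟨h1, h2, rfl⟩) <;> simp [IsArm]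
  · rintro w hv ha
    cases w with
    | root => right; exact ⟨q1, Or.inr (Or.inr (Or.inl ⟨le_rfl, hqr, rfl⟩))⟩
    | leaf i => left; exact ⟨_, ow3 i hv⟩
    | x j =>
      simp only [CValid] at hv
      by_cases h0 : j = 0
      · subst h0; left; exact ⟨_, ow0⟩
      by_cases h1 : j = ℓ + 1
      · subst h1; left; exact ⟨_, ow1⟩
      right
      refine ⟨z1 - ℓ + j, ?_⟩
      right; right; right; right; left
      refine ⟨by omega, by omega, ?_⟩
      congr 1; omega
    | y j =>
      simp only [CValid] at hv
      by_cases h1 : j = ℓ + 1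
      · subst h1; left; exact ⟨_, ow2⟩
      right
      refine ⟨q1 - 1 - j, ?_⟩
      right; left
      refine ⟨by omega, by omega, ?_⟩
      congr 1; omega
    | pd p j =>
      simp only [CValid] at hv
      right
      obtain ⟨hp, hj⟩ := hv
      interval_cases p
      · refine ⟨hi' + 1 + j, ?_⟩
        right; right; right; right; right
        refine ⟨by omega, by omega, ?_⟩
        congr 1; omega
      · refine ⟨lo - 1 - j, ?_⟩
        left
        refine ⟨by omega, by omega, ?_⟩
        congr 1; omega
      · refine ⟨lo' - 1 - j, ?_⟩
        right; right; right; left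
        refine ⟨by omega, by omega, ?_⟩
        congr 1; omega
    | arm u k j => exact absurd trivial ha
    | free i => left; exact ⟨_, ow4 i hv⟩
  · rintro i j k w (⟨h1, h2, rfl⟩ | ⟨h1, h2, rfl⟩ | ⟨h1, h2, rfl⟩ | ⟨h1, h2, rfl⟩ | ⟨h1, h2, rfl⟩ | ⟨h1, h2, rfl⟩)
      (⟨h1', h2', h3⟩ | ⟨h1', h2', h3⟩ | ⟨h1', h2', h3⟩ | ⟨h1', h2', h3⟩ | ⟨h1', h2', h3⟩ | ⟨h1', h2', h3⟩) hij hjk <;>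
    simp at h3
    · left; exact ⟨by omega, by omega, by congr 1; omega⟩
    · right; left; exact ⟨by omega, by omega, by congr 1; omega⟩
    · right; right; left; exact ⟨by omega, by omega, rfl⟩
    · right; right; right; left; exact ⟨by omega, by omega, by congr 1; omega⟩
    · right; right; right; right; left; exact ⟨by omega, by omega, by congr 1; omega⟩
    · right; right; right; right; right; exact ⟨by omega, by omega, by congr 1; omega⟩
  · rintro i w s hl (⟨u, hu, rfl, rfl⟩ | ⟨h, _⟩)
    · exfalso
      rcases hl with ⟨h1, h2, h3⟩ | ⟨h1, h2, h3⟩ | ⟨h1, h2, h3⟩ | ⟨h1, h2, h3⟩ | ⟨h1, h2, h3⟩ | ⟨h1, h2, h3⟩ <;>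
      rcases csite_cases hu with ⟨a, b⟩ | ⟨a, b⟩ | ⟨a, b⟩ | ⟨i, hi, a, b⟩ | ⟨i, hi, a, b⟩ <;>
      rw [b] at h3 <;> simp at h3 <;> omega
    · simp at h
  · rintro i u v (⟨h1, h2, rfl⟩ | ⟨h1, h2, rfl⟩ | ⟨h1, h2, rfl⟩ | ⟨h1, h2, rfl⟩ | ⟨h1, h2, rfl⟩ | ⟨h1, h2, rfl⟩)
      (⟨h1', h2', rfl⟩ | ⟨h1', h2', rfl⟩ | ⟨h1', h2', rfl⟩ | ⟨h1', h2', rfl⟩ | ⟨h1', h2', rfl⟩ | ⟨h1', h2', rfl⟩) <;>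
    first
    | (exfalso; omega)
    | (simp [BA, catt]; done)
    | (simp [BA, catt]; omega)
  · rintro i u w s hl (⟨v, hv, rfl, rfl⟩ | ⟨h, _⟩) hA
    swap
    · simp at h
    have hi0 : ∀ u < 2 * ℓ + 3, hs u = hs v → v = u := fun u hu h => hinj v u hv hu h.symm
    rcases hl with ⟨h1, h2, rfl⟩ | ⟨h1, h2, rfl⟩ | ⟨h1, h2, rfl⟩ | ⟨h1, h2, rfl⟩ | ⟨h1, h2, rfl⟩ | ⟨h1, h2, rfl⟩
    · exact absurd hA (hlo4 _ _ h1 h2)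
    · have hip : i ≤ p := by by_contra hcon; exact hgapA i _ (by omega) h2 hA
      have := hlo5 _ _ h1 hip hA
      have hv2 := hi0 2 (by omega) (by rw [hs2, this])
      subst hv2
      rw [cs2]; simp [BA]; omega
    · have hK := hmid i _ (by omega) (by omega) hA
      rcases csite_cases hv with ⟨rfl, b⟩ | ⟨rfl, b⟩ | ⟨rfl, b⟩ | ⟨i, hi, rfl, b⟩ | ⟨i, hi, rfl, b⟩
      · rw [b]; simp [BA]
      · rw [hs1] at hK; omega
      · rw [hs2] at hK; omega
      · rw [b]; simp [BA]
      · rw [hs4] at hK; have := hfr i hi; omega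
    · exact absurd hA (hl4 _ _ h1 h2)
    · rcases le_or_gt i p2 with hip | hip
      · have := hl5 _ _ h1 hip hA
        have hv2 := hi0 0 (by omega) (by rw [hs0, this])
        subst hv2
        rw [cs0]; simp [BA]; omega
      · rcases lt_or_ge i z1 with hiz | hiz
        · exact absurd hA (hgapB _ _ hip hiz)
        · have := hh5 _ _ hiz h2 hA
          have hv2 := hi0 1 (by omega) (by rw [hs1, this])
          subst hv2
          rw [cs1]; simp [BA]; omega
    · exact absurd hA (hh4 _ _ h2 h1)
  · intro u v hu hv ha hB
    rcases BA_cases hB ha with ⟨rfl, i, rfl⟩ | ⟨rfl, rfl⟩ | ⟨rfl, rfl⟩ | ⟨j, rfl, rfl⟩ | ⟨j, rfl, rfl⟩ | ⟨p', j, rfl, rfl⟩ | ⟨p', rfl, rfl⟩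
    · simp only [CValid] at hv
      obtain ⟨k, hk1, hk2, hk3⟩ := hleaf (lf i) (by simp only [lf]; omega)
      right; right; left
      exact ⟨k, lf i, Or.inr (Or.inr (Or.inl ⟨hk1, hk2, rfl⟩)), ow3 i hv, hk3⟩
    · right; right; left
      exact ⟨q1, T, Or.inr (Or.inr (Or.inl ⟨le_rfl, hqr, rfl⟩)), ow0, hq1c⟩
    · right; left
      refine ⟨q1 - 1, Or.inr (Or.inl ⟨by omega, by omega, by congr 1; omega⟩),
        Or.inr (Or.inr (Or.inl ⟨by omega, by omega, rfl⟩))⟩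
    · simp only [CValid] at hv
      by_cases h0 : j = 0
      · subst h0
        right; right; right
        exact ⟨p2, T, Or.inr (Or.inr (Or.inr (Or.inr (Or.inl ⟨hl1, by omega, by congr 1; omega⟩)))),
          ow0, hp2c⟩
      by_cases h1 : j = ℓ
      · subst h1
        right; right; left
        exact ⟨z1, b, Or.inr (Or.inr (Or.inr (Or.inr (Or.inl ⟨by omega, by omega, by congr 1; omega⟩)))),
          ow1, hz1b⟩
      left
      exact ⟨z1 - ℓ + j, Or.inr (Or.inr (Or.inr (Or.inr (Or.inl ⟨by omega, by omega, by congr 1; omega⟩)))),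
        Or.inr (Or.inr (Or.inr (Or.inr (Or.inl ⟨by omega, by omega, by congr 1; omega⟩))))⟩
    · simp only [CValid] at hv
      by_cases h1 : j = ℓ
      · subst h1
        right; right; left
        exact ⟨p, c, Or.inr (Or.inl ⟨by omega, by omega, by congr 1; omega⟩), ow2, hc⟩
      right; left
      exact ⟨q1 - 1 - (j + 1), Or.inr (Or.inl ⟨by omega, by omega, by congr 1; omega⟩),
        Or.inr (Or.inl ⟨by omega, by omega, by congr 1; omega⟩)⟩
    · simp only [CValid] at hv
      obtain ⟨hp, hj⟩ := hv
      interval_cases p'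
      · left
        exact ⟨hi' + 1 + j,
          Or.inr (Or.inr (Or.inr (Or.inr (Or.inr ⟨by omega, by omega, by congr 1; omega⟩)))),
          Or.inr (Or.inr (Or.inr (Or.inr (Or.inr ⟨by omega, by omega, by congr 1; omega⟩))))⟩
      · right; left
        exact ⟨lo - 1 - (j + 1), Or.inl ⟨by omega, by omega, by congr 1; omega⟩,
          Or.inl ⟨by omega, by omega, by congr 1; omega⟩⟩
      · right; left
        exact ⟨lo' - 1 - (j + 1), Or.inr (Or.inr (Or.inr (Or.inl ⟨by omega, by omega, by congr 1; omega⟩))),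
          Or.inr (Or.inr (Or.inr (Or.inl ⟨by omega, by omega, by congr 1; omega⟩)))⟩
    · simp only [CValid] at hv
      obtain ⟨hp, hj⟩ := hv
      interval_cases p' <;> simp only [catt] <;> norm_num
      · left
        exact ⟨hi', Or.inr (Or.inr (Or.inr (Or.inr (Or.inl ⟨by omega, by omega, by congr 1; omega⟩)))),
          Or.inr (Or.inr (Or.inr (Or.inr (Or.inr ⟨by omega, by omega, by congr 1; omega⟩))))⟩
      · right; left
        exact ⟨lo - 1, Or.inl ⟨by omega, by omega, by congr 1; omega⟩,
          Or.inr (Or.inl ⟨by omega, by omega, by congr 1; omega⟩)⟩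
      · right; left
        exact ⟨lo' - 1, Or.inr (Or.inr (Or.inr (Or.inl ⟨by omega, by omega, by congr 1; omega⟩))),
          Or.inr (Or.inr (Or.inr (Or.inr (Or.inl ⟨by omega, by omega, by congr 1; omega⟩))))⟩

theorem exists_order {ℓ m : ℕ} {A : Fin (2 * ℓ + 4) → ℕ → Prop} (W : Wd ℓ m A) :
    ∃ (τ : ℕ → Fin (2 * ℓ + 4)) (pos : ℕ → ℕ),
      (∀ i < 2 * ℓ + 3, A (τ i) (pos i) ∧ τ i ≠ Fin.last _ ∧ ∀ k, A (τ i) k → k ≤ pos i) ∧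
      (∀ i j, i < j → j < 2 * ℓ + 3 → pos i < pos j) ∧
      (∀ i j, i < 2 * ℓ + 3 → j < 2 * ℓ + 3 → τ i = τ j → i = j) ∧
      (∀ s, s ≠ Fin.last _ → ∃ i < 2 * ℓ + 3, τ i = s) := by
  classical
  have hlast : ∀ s, ∃ x, A s x ∧ ∀ y, A s y → y ≤ x := fun s =>
    exists_max m (fun y hy => by have := (W.lt s y hy).2; omega) (W.occ s)
  choose L hL1 hL2 using hlast
  have hLinj : Function.Injective L := by
    intro s t h
    by_contra hne
    have := W.far s t (L s) (L t) (hL1 s) (hL1 t) hne h.le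
    omega
  set D := (Finset.univ.erase (Fin.last (2 * ℓ + 3))).image L with hD
  have hcard : D.card = 2 * ℓ + 3 := by
    rw [hD, Finset.card_image_of_injective _ hLinj]; simp
  let e := D.orderEmbOfFin hcard
  have he : ∀ i, ∃ s, s ≠ Fin.last (2 * ℓ + 3) ∧ L s = e i := by
    intro i
    have := D.orderEmbOfFin_mem hcard i
    have this := Finset.mem_image.1 this
    obtain ⟨s, hs, h⟩ := this
    exact ⟨s, by simpa using hs, h⟩
  choose t ht1 ht2 using he
  refine ⟨fun i => if h : i < 2 * ℓ + 3 then t ⟨i, h⟩ else 0,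
    fun i => if h : i < 2 * ℓ + 3 then e ⟨i, h⟩ else 0, ?_, ?_, ?_, ?_⟩
  · intro i hi
    simp only [hi, dif_pos]
    rw [← ht2]
    exact ⟨hL1 _, ht1 _, hL2 _⟩
  · intro i j hij hj
    have hi : i < 2 * ℓ + 3 := by omega
    simp only [hi, hj, dif_pos]
    exact e.strictMono (Fin.mk_lt_mk.2 hij)
  · intro i j hi hj h
    simp only [hi, hj, dif_pos] at h
    have := congrArg L h
    rw [ht2, ht2] at this
    simpa using e.injective this
  · intro s hs
    have : L s ∈ D := by rw [hD]; exact Finset.mem_image_of_mem _ (by simpa using hs)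
    have h2 : L s ∈ Set.range e := by
      rw [Finset.range_orderEmbOfFin]; exact this
    obtain ⟨i, hi⟩ := h2
    refine ⟨i, i.2, ?_⟩
    simp only [i.2, dif_pos]
    apply hLinj
    rw [ht2, ← hi]

set_option maxHeartbeats 4000000 in
theorem core3 {ℓ m : ℕ} (hℓ : 2 ≤ ℓ) {A : Fin (2 * ℓ + 4) → ℕ → Prop} (W : Wd ℓ m A) :
    ∃ hs Lab, CoreLab ℓ true m A hs Lab := by
  classical
  obtain ⟨τ, pos, hτ, hpos, hτi, hτs⟩ := exists_order W
  set T : Fin (2 * ℓ + 4) := Fin.last _ with hT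
  have hltT : ∀ s : Fin (2 * ℓ + 4), s ≠ T → s < T := fun s hs => lt_of_le_of_ne (Fin.le_last s) hs
  have hnx : ∀ i, i < 2 * ℓ + 2 → ∃ q, (pos i < q ∧ A T q) ∧ q < pos (i + 1) ∧
      ∀ y, (pos i < y ∧ A T y) → q ≤ y := by
    intro i hi
    obtain ⟨a1, a2, a3⟩ := hτ i (by omega)
    obtain ⟨b1, b2, b3⟩ := hτ (i + 1) (by omega)
    obtain ⟨k, h1, h2, h3⟩ := W.intr (τ i) (τ (i + 1)) T (pos i) (pos (i + 1)) a1 b1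
      (fun h => by have := hτi _ _ (by omega) (by omega) h; omega) (hltT _ a2) (hltT _ b2)
      (hpos i (i + 1) (by omega) (by omega)).le
    obtain ⟨q, hq1, hq2⟩ := exists_min (Q := fun y => pos i < y ∧ A T y) ⟨k, h1, h3⟩
    exact ⟨q, hq1, by have := hq2 k ⟨h1, h3⟩; omega, hq2⟩
  choose! nx hnx1 hnx2 hnx3 using hnx
  have hgap : ∀ i, i < 2 * ℓ + 2 → ∀ j t, pos i < j → j < nx i → ¬ A t j := by
    intro i hi j t h1 h2 ht
    obtain ⟨a1, a2, a3⟩ := hτ i (by omega)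
    by_cases htT : t = T
    · subst htT; have := hnx3 i hi j ⟨h1, ht⟩; omega
    · obtain ⟨k, h3, h4, h5⟩ := W.intr (τ i) t T (pos i) j a1 ht
        (by rintro rfl; have := a3 _ ht; omega) (hltT _ a2) (hltT _ htT) h1.le
      have := hnx3 i hi k ⟨h3, h5⟩; omega
  have hfar1 : ∀ i, i < 2 * ℓ + 2 → pos i + ℓ + 1 ≤ nx i := fun i hi =>
    W.far _ _ _ _ (hτ i (by omega)).1 (hnx1 i hi).2 (hτ i (by omega)).2.1 (hnx1 i hi).1.le
  have hfar2 : ∀ i, i < 2 * ℓ + 2 → nx i + ℓ + 1 ≤ pos (i + 1) := fun i hi =>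
    W.far _ _ _ _ (hnx1 i hi).2 (hτ (i + 1) (by omega)).1 (Ne.symm (hτ (i + 1) (by omega)).2.1)
      (hnx2 i hi).le
  have hle : ∀ i j, i ≤ j → j < 2 * ℓ + 3 → pos i ≤ pos j := by
    intro i j hij hj
    rcases hij.lt_or_eq with h | h
    · exact (hpos i j h hj).le
    · rw [h]
  have hfar3 : ∀ i j, i < j → j < 2 * ℓ + 3 → nx i + ℓ + 1 ≤ pos j := fun i j hij hj =>
    (hfar2 i (by omega)).trans (hle _ _ hij hj)
  let π : ℕ → ℕ := fun u => if u = 0 then 2 * ℓ + 1 else if u = 1 then 2 * ℓ + 2 else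
    if u = 2 then 0 else if u = 2 * ℓ + 2 then 1 else u - 1
  let hs : ℕ → Fin (2 * ℓ + 4) := fun u => τ (π u)
  have hπ : ∀ u < 2 * ℓ + 3, π u < 2 * ℓ + 3 := by
    intro u hu; simp only [π]; split_ifs <;> omega
  have hπi : ∀ u v, u < 2 * ℓ + 3 → v < 2 * ℓ + 3 → π u = π v → u = v := by
    intro u v hu hv h; simp only [π] at h; split_ifs at h <;> omega
  have hs0 : hs 0 = τ (2 * ℓ + 1) := by simp [hs, π]
  have hs1 : hs 1 = τ (2 * ℓ + 2) := by simp [hs, π]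
  have hs2 : hs 2 = τ 0 := by simp [hs, π]
  have hs3 : ∀ i < ℓ, hs (i + 3) = τ (i + 2) := by
    intro i hi; simp only [hs, π]
    rw [if_neg (by omega), if_neg (by omega), if_neg (by omega), if_neg (by omega)]
    congr 1
  have hinj : ∀ u v, u < 2 * ℓ + 3 → v < 2 * ℓ + 3 → hs u = hs v → u = v := fun u v hu hv h =>
    hπi u v hu hv (hτi _ _ (hπ u hu) (hπ v hv) h)
  have hst : ∀ u < 2 * ℓ + 3, hs u ≠ T := fun u hu => (hτ _ (hπ u hu)).2.1
  -- y part
  obtain ⟨lo, hlo1, hlo2, hlo3, hlo4, hlo5⟩ := W.leftrun (hτ 0 (by omega)).1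
  obtain ⟨hi, hh1, hh2, hh3, hh4, hh5⟩ := W.rightrun (hnx1 0 (by omega)).2
  have hsepy : hi + ℓ < pos 1 := by
    by_contra hcon
    have ha := hτ 1 (by omega)
    have h7 := hnx2 0 (by omega)
    rcases le_or_gt (pos 1) hi with h | h
    · exact ha.2.1 (hh5 _ _ h7.le h ha.1)
    · exact hh4 _ _ (by omega) h ha.1
  have hpos12 := hpos 1 2 (by omega) (by omega)
  -- x part
  set pa := pos (2 * ℓ + 1) with hpa
  obtain ⟨qb, ⟨hqb1, hqb2⟩, hqb3⟩ := exists_min (Q := fun i => pa < i ∧ A (τ (2 * ℓ + 2)) i)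
    ⟨pos (2 * ℓ + 2), hpos _ _ (by omega) (by omega), (hτ _ (by omega)).1⟩
  have hgapx : ∀ i t, pa < i → i < qb → A t i → t = T ∧ i + ℓ + 1 ≤ qb := by
    intro i t h1 h2 ht
    have htT : t = T := by
      by_contra htT
      obtain ⟨k, hk, rfl⟩ := hτs t htT
      have h3 := (hτ k hk).2.2 _ ht
      rcases Nat.lt_or_ge k (2 * ℓ + 2) with hk2 | hk2
      · have := hle k (2 * ℓ + 1) (by omega) (by omega); omega
      · have : k = 2 * ℓ + 2 := by omega
        subst this
        have := hqb3 i ⟨h1, ht⟩; omega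
    subst htT
    exact ⟨rfl, W.far _ _ _ _ ht hqb2 (Ne.symm (hτ _ (by omega)).2.1) h2.le⟩
  have hpaqb := W.far _ _ _ _ (hτ (2 * ℓ + 1) (by omega)).1 hqb2 (fun h => by
    have := hτi _ _ (by omega) (by omega) h; omega) hqb1.le
  obtain ⟨kT, hkT1, hkT2, hkT3⟩ := W.intr _ _ T _ _ (hτ (2 * ℓ + 1) (by omega)).1 hqb2 (fun h => by
    have := hτi _ _ (by omega) (by omega) h; omega) (hltT _ (hτ _ (by omega)).2.1)
    (hltT _ (hτ _ (by omega)).2.1) hqb1.le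
  rw [← hpa] at hkT1 hpaqb
  have hkT4 := (hgapx _ _ hkT1 hkT2 hkT3).2
  obtain ⟨hx, hx1, hx2, hx3, hx4, hx5⟩ := W.rightrun hqb2
  have hL : ∀ k < ℓ, pos (k + 2) + ℓ + 1 ≤ nx (k + 2) ∧ nx (k + 2) + ℓ + 1 ≤ pa ∧
      hi + ℓ + 1 < pos (k + 2) := by
    intro k hk
    refine ⟨hfar1 _ (by omega), hfar3 _ _ (by omega) (by omega), ?_⟩
    have := hle 2 (k + 2) (by omega) (by omega); omega
  have hLL : ∀ k k', k < k' → k' < ℓ → nx (k + 2) + ℓ + 1 ≤ pos (k' + 2) := fun k k' h h' =>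
    hfar3 _ _ (by omega) (by omega)
  have hLL' : ∀ k k', k < ℓ → k' < ℓ → k = k' ∨ nx (k + 2) + ℓ + 1 ≤ pos (k' + 2) ∨
      nx (k' + 2) + ℓ + 1 ≤ pos (k + 2) := by
    intro k k' h h'
    rcases lt_trichotomy k k' with h1 | h1 | h1
    · right; left; exact hLL _ _ h1 h'
    · left; exact h1
    · right; right; exact hLL _ _ h1 h
  have hq0 := hfar1 0 (by omega)
  have hhipa : hi + ℓ + 1 < pa := by have := hle 2 (2 * ℓ + 1) (by omega) (by omega); omega
  let Lab : ℕ → CV → Prop := fun i w =>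
    (lo ≤ i + ℓ ∧ i < lo ∧ w = .pd 1 (lo - 1 - i)) ∨
    (lo ≤ i ∧ i ≤ hi ∧ w = .y (min (nx 0 - i) ℓ)) ∨
    (hi < i ∧ i ≤ hi + ℓ ∧ w = .pd 2 (i - hi - 1)) ∨
    (∃ k < ℓ, pos (k + 2) ≤ i ∧ i ≤ nx (k + 2) ∧ w = .leaf k) ∨
    (pa ≤ i ∧ i ≤ hx ∧ w = .x (min (i - (qb - ℓ)) ℓ)) ∨
    (hx < i ∧ i ≤ hx + ℓ ∧ w = .pd 0 (i - hx - 1))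
  have hown : ∀ u < 2 * ℓ + 3, COwn ℓ true hs (csite ℓ u) (hs u) := fun u hu =>
    Or.inl ⟨u, hu, rfl, rfl⟩
  have cs0 : csite ℓ 0 = .x 0 := by simp [csite]
  have cs1 : csite ℓ 1 = .x (ℓ + 1) := by simp [csite]
  have cs2 : csite ℓ 2 = .y (ℓ + 1) := by simp [csite]
  have ow0 : COwn ℓ true hs (.x 0) (τ (2 * ℓ + 1)) := by have := hown 0 (by omega); rwa [cs0, hs0] at this
  have ow1 : COwn ℓ true hs (.x (ℓ + 1)) (τ (2 * ℓ + 2)) := by have := hown 1 (by omega); rwa [cs1, hs1] at this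
  have ow2 : COwn ℓ true hs (.y (ℓ + 1)) (τ 0) := by have := hown 2 (by omega); rwa [cs2, hs2] at this
  have ow3 : ∀ i < ℓ, COwn ℓ true hs (.leaf i) (τ (i + 2)) := by
    intro i hi; have := hown (i + 3) (by omega); rwa [csite_leaf hi, hs3 i hi] at this
  have owr : COwn ℓ true hs .root T := Or.inr ⟨rfl, rfl, rfl⟩
  refine ⟨hs, Lab, ⟨hinj, fun _ => hst, ?_, ?_, ?_, ?_, ?_, ?_, ?_, ?_, ?_⟩⟩
  · rintro i w (⟨h1, h2, rfl⟩ | ⟨h1, h2, rfl⟩ | ⟨h1, h2, rfl⟩ | ⟨k, hk, h1, h2, rfl⟩ | ⟨h1, h2, rfl⟩ | ⟨h1, h2, rfl⟩) <;>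
    first
    | omega
    | (have := hL k hk; omega)
  · rintro i w w' (⟨h1, h2, rfl⟩ | ⟨h1, h2, rfl⟩ | ⟨h1, h2, rfl⟩ | ⟨k, hk, h1, h2, rfl⟩ | ⟨h1, h2, rfl⟩ | ⟨h1, h2, rfl⟩)
      (⟨h1', h2', rfl⟩ | ⟨h1', h2', rfl⟩ | ⟨h1', h2', rfl⟩ | ⟨k', hk', h1', h2', rfl⟩ | ⟨h1', h2', rfl⟩ | ⟨h1', h2', rfl⟩) <;>
    first
    | rfl
    | omega
    | (have := hLL' k k' hk hk'; congr 1; omega)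
    | (have := hL k hk; omega)
    | (have := hL k' hk'; omega)
  · rintro i w (⟨h1, h2, rfl⟩ | ⟨h1, h2, rfl⟩ | ⟨h1, h2, rfl⟩ | ⟨k, hk, h1, h2, rfl⟩ | ⟨h1, h2, rfl⟩ | ⟨h1, h2, rfl⟩) <;> simp [IsArm]
  · rintro w hv ha
    cases w with
    | root => left; exact ⟨_, owr⟩
    | leaf i => left; exact ⟨_, ow3 i hv⟩
    | x j =>
      simp only [CValid] at hv
      by_cases h0 : j = 0
      · subst h0; left; exact ⟨_, ow0⟩
      by_cases h1 : j = ℓ + 1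
      · subst h1; left; exact ⟨_, ow1⟩
      right
      refine ⟨qb - ℓ + j, ?_⟩
      right; right; right; right; left
      refine ⟨by omega, by omega, ?_⟩
      congr 1; omega
    | y j =>
      simp only [CValid] at hv
      by_cases h1 : j = ℓ + 1
      · subst h1; left; exact ⟨_, ow2⟩
      right
      refine ⟨nx 0 - j, ?_⟩
      right; left
      refine ⟨by omega, by omega, ?_⟩
      congr 1; omega
    | pd p j =>
      simp only [CValid] at hv
      right
      obtain ⟨hp, hj⟩ := hv
      interval_cases p
      · refine ⟨hx + 1 + j, ?_⟩
        right; right; right; right; right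
        refine ⟨by omega, by omega, ?_⟩
        congr 1; omega
      · refine ⟨lo - 1 - j, ?_⟩
        left
        refine ⟨by omega, by omega, ?_⟩
        congr 1; omega
      · refine ⟨hi + 1 + j, ?_⟩
        right; right; left
        refine ⟨by omega, by omega, ?_⟩
        congr 1; omega
    | arm u k j => exact absurd trivial ha
    | free i =>
      left; simp only [CValid] at hv
      exact ⟨hs (ℓ + 3 + i), by have := hown (ℓ + 3 + i) (by omega); rwa [csite_free] at this⟩
  · rintro i j k w (⟨h1, h2, rfl⟩ | ⟨h1, h2, rfl⟩ | ⟨h1, h2, rfl⟩ | ⟨k1, hk1, h1, h2, rfl⟩ | ⟨h1, h2, rfl⟩ | ⟨h1, h2, rfl⟩)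
      (⟨h1', h2', h3⟩ | ⟨h1', h2', h3⟩ | ⟨h1', h2', h3⟩ | ⟨k2, hk2, h1', h2', h3⟩ | ⟨h1', h2', h3⟩ | ⟨h1', h2', h3⟩) hij hjk <;>
    simp at h3
    · left; exact ⟨by omega, by omega, by congr 1; omega⟩
    · right; left; exact ⟨by omega, by omega, by congr 1; omega⟩
    · right; right; left; exact ⟨by omega, by omega, by congr 1; omega⟩
    · right; right; right; left
      subst h3
      exact ⟨k1, hk1, by omega, by omega, rfl⟩
    · right; right; right; right; left; exact ⟨by omega, by omega, by congr 1; omega⟩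
    · right; right; right; right; right; exact ⟨by omega, by omega, by congr 1; omega⟩
  · rintro i w s hl (⟨u, hu, rfl, rfl⟩ | ⟨_, rfl, rfl⟩)
    · rcases csite_cases hu with ⟨rfl, b⟩ | ⟨rfl, b⟩ | ⟨rfl, b⟩ | ⟨i', hi', rfl, b⟩ | ⟨i', hi', rfl, b⟩
      · refine ⟨pa, Or.inr (Or.inr (Or.inr (Or.inr (Or.inl ⟨by omega, by omega, ?_⟩)))), ?_⟩
        · rw [b]; congr 1; omega
        · rw [hs0]; exact (hτ _ (by omega)).1
      · exfalso
        rw [b] at hl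
        rcases hl with ⟨h1, h2, h3⟩ | ⟨h1, h2, h3⟩ | ⟨h1, h2, h3⟩ | ⟨k, hk, h1, h2, h3⟩ | ⟨h1, h2, h3⟩ | ⟨h1, h2, h3⟩ <;>
        simp at h3 <;> omega
      · exfalso
        rw [b] at hl
        rcases hl with ⟨h1, h2, h3⟩ | ⟨h1, h2, h3⟩ | ⟨h1, h2, h3⟩ | ⟨k, hk, h1, h2, h3⟩ | ⟨h1, h2, h3⟩ | ⟨h1, h2, h3⟩ <;>
        simp at h3 <;> omega
      · have := hL i' hi'
        refine ⟨pos (i' + 2), Or.inr (Or.inr (Or.inr (Or.inl ⟨i', hi', by omega, by omega, b⟩))), ?_⟩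
        rw [hs3 i' hi']; exact (hτ _ (by omega)).1
      · exfalso
        rw [b] at hl
        rcases hl with ⟨h1, h2, h3⟩ | ⟨h1, h2, h3⟩ | ⟨h1, h2, h3⟩ | ⟨k, hk, h1, h2, h3⟩ | ⟨h1, h2, h3⟩ | ⟨h1, h2, h3⟩ <;>
        simp at h3
    · exfalso
      rcases hl with ⟨h1, h2, h3⟩ | ⟨h1, h2, h3⟩ | ⟨h1, h2, h3⟩ | ⟨k, hk, h1, h2, h3⟩ | ⟨h1, h2, h3⟩ | ⟨h1, h2, h3⟩ <;>
      simp at h3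
  · rintro i u v (⟨h1, h2, rfl⟩ | ⟨h1, h2, rfl⟩ | ⟨h1, h2, rfl⟩ | ⟨k, hk, h1, h2, rfl⟩ | ⟨h1, h2, rfl⟩ | ⟨h1, h2, rfl⟩)
      (⟨h1', h2', rfl⟩ | ⟨h1', h2', rfl⟩ | ⟨h1', h2', rfl⟩ | ⟨k', hk', h1', h2', rfl⟩ | ⟨h1', h2', rfl⟩ | ⟨h1', h2', rfl⟩) <;>
    first
    | (exfalso; omega)
    | (have := hLL' k k' hk hk'; left; congr 1; omega)
    | (have := hL k hk; exfalso; omega)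
    | (have := hL k' hk'; exfalso; omega)
    | (simp [BA, catt]; done)
    | (simp [BA, catt]; omega)
  · intro i u w s hl ho hA
    have hroot : s = T → w = .root := by
      rintro rfl
      rcases ho with ⟨v, hv, rfl, h⟩ | ⟨_, rfl, _⟩
      · exact absurd h.symm (hst v hv)
      · rfl
    have hsite : ∀ v < 2 * ℓ + 3, s = hs v → w = csite ℓ v := by
      rintro v hv rfl
      rcases ho with ⟨v', hv', rfl, h⟩ | ⟨_, rfl, h⟩
      · rw [hinj _ _ hv hv' h]
      · exact absurd h (hst v hv)
    rcases hl with ⟨h1, h2, rfl⟩ | ⟨h1, h2, rfl⟩ | ⟨h1, h2, rfl⟩ | ⟨k, hk, h1, h2, rfl⟩ | ⟨h1, h2, rfl⟩ | ⟨h1, h2, rfl⟩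
    · exact absurd hA (hlo4 _ _ h1 h2)
    · rcases le_or_gt i (pos 0) with hip | hip
      · rw [hsite 2 (by omega) (by rw [hs2]; exact hlo5 _ _ h1 hip hA), cs2]
        simp [BA]; omega
      · rcases lt_or_ge i (nx 0) with hiz | hiz
        · exact absurd hA (hgap 0 (by omega) _ _ hip hiz)
        · rw [hroot (hh5 _ _ hiz h2 hA)]
          simp [BA]; omega
    · exact absurd hA (hh4 _ _ h2 h1)
    · have h3 := hL k hk
      by_cases hi1 : i = pos (k + 2)
      · left
        have hsk : s = τ (k + 2) := by
          by_contra hne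
          have := W.far _ _ _ _ hA (hτ (k + 2) (by omega)).1 hne hi1.le
          omega
        rw [hsite (k + 3) (by omega) (by rw [hs3 k hk, hsk]), csite_leaf hk]
      · by_cases hi2 : i = nx (k + 2)
        · have hsk : s = T := by
            by_contra hne
            have := W.far _ _ _ _ hA (hnx1 (k + 2) (by omega)).2 hne hi2.le
            omega
          rw [hroot hsk]; simp [BA]
        · exact absurd hA (hgap (k + 2) (by omega) _ _ (by omega) (by omega))
    · by_cases hi1 : i = pa
      · have hsk : s = τ (2 * ℓ + 1) := by
          by_contra hne
          have := W.far _ _ _ _ hA (hτ (2 * ℓ + 1) (by omega)).1 hne hi1.le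
          omega
        rw [hsite 0 (by omega) (by rw [hs0, hsk]), cs0]
        left; congr 1; omega
      · rcases lt_or_ge i qb with hiz | hiz
        · have h5 := hgapx _ _ (by omega) hiz hA
          rw [hroot h5.1]; simp [BA]; omega
        · rw [hsite 1 (by omega) (by rw [hs1]; exact hx5 _ _ hiz h2 hA), cs1]
          simp [BA]; omega
    · exact absurd hA (hx4 _ _ h2 h1)
  · intro u v hu hv ha hB
    rcases BA_cases hB ha with ⟨rfl, i, rfl⟩ | ⟨rfl, rfl⟩ | ⟨rfl, rfl⟩ | ⟨j, rfl, rfl⟩ | ⟨j, rfl, rfl⟩ | ⟨p', j, rfl, rfl⟩ | ⟨p', rfl, rfl⟩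
    · simp only [CValid] at hv
      have := hL i hv
      right; right; right
      exact ⟨nx (i + 2), T, Or.inr (Or.inr (Or.inr (Or.inl ⟨i, hv, by omega, le_rfl, rfl⟩))), owr,
        (hnx1 _ (by omega)).2⟩
    · right; right; right
      exact ⟨kT, T, Or.inr (Or.inr (Or.inr (Or.inr (Or.inl ⟨by omega, by omega, by congr 1; omega⟩)))),
        owr, hkT3⟩
    · right; right; right
      exact ⟨nx 0, T, Or.inr (Or.inl ⟨by omega, by omega, by congr 1; omega⟩), owr,
        (hnx1 0 (by omega)).2⟩
    · simp only [CValid] at hv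
      by_cases h1 : j = ℓ
      · subst h1
        right; right; left
        exact ⟨qb, _, Or.inr (Or.inr (Or.inr (Or.inr (Or.inl ⟨by omega, by omega, by congr 1; omega⟩)))),
          ow1, hqb2⟩
      left
      exact ⟨qb - ℓ + j, Or.inr (Or.inr (Or.inr (Or.inr (Or.inl ⟨by omega, by omega, by congr 1; omega⟩)))),
        Or.inr (Or.inr (Or.inr (Or.inr (Or.inl ⟨by omega, by omega, by congr 1; omega⟩))))⟩
    · simp only [CValid] at hv
      by_cases h1 : j = ℓ
      · subst h1
        right; right; left
        exact ⟨pos 0, _, Or.inr (Or.inl ⟨by omega, by omega, by congr 1; omega⟩), ow2,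
          (hτ 0 (by omega)).1⟩
      right; left
      exact ⟨nx 0 - (j + 1), Or.inr (Or.inl ⟨by omega, by omega, by congr 1; omega⟩),
        Or.inr (Or.inl ⟨by omega, by omega, by congr 1; omega⟩)⟩
    · simp only [CValid] at hv
      obtain ⟨hp, hj⟩ := hv
      interval_cases p'
      · left
        exact ⟨hx + 1 + j,
          Or.inr (Or.inr (Or.inr (Or.inr (Or.inr ⟨by omega, by omega, by congr 1; omega⟩)))),
          Or.inr (Or.inr (Or.inr (Or.inr (Or.inr ⟨by omega, by omega, by congr 1; omega⟩))))⟩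
      · right; left
        exact ⟨lo - 1 - (j + 1), Or.inl ⟨by omega, by omega, by congr 1; omega⟩,
          Or.inl ⟨by omega, by omega, by congr 1; omega⟩⟩
      · left
        exact ⟨hi + 1 + j,
          Or.inr (Or.inr (Or.inl ⟨by omega, by omega, by congr 1; omega⟩)),
          Or.inr (Or.inr (Or.inl ⟨by omega, by omega, by congr 1; omega⟩))⟩
    · simp only [CValid] at hv
      obtain ⟨hp, hj⟩ := hv
      interval_cases p' <;> simp only [catt] <;> norm_num
      · left
        exact ⟨hx, Or.inr (Or.inr (Or.inr (Or.inr (Or.inl ⟨by omega, by omega, by congr 1; omega⟩)))),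
          Or.inr (Or.inr (Or.inr (Or.inr (Or.inr ⟨by omega, by omega, by congr 1; omega⟩))))⟩
      · right; left
        exact ⟨lo - 1, Or.inl ⟨by omega, by omega, by congr 1; omega⟩,
          Or.inr (Or.inl ⟨by omega, by omega, by congr 1; omega⟩)⟩
      · left
        exact ⟨hi, Or.inr (Or.inl ⟨by omega, by omega, by congr 1; omega⟩),
          Or.inr (Or.inr (Or.inl ⟨by omega, by omega, by congr 1; omega⟩))⟩


theorem Wd.rev {ℓ m : ℕ} {A : Fin (2 * ℓ + 4) → ℕ → Prop} (W : Wd ℓ m A) :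
    Wd ℓ m (fun s i => i < m ∧ A s (m - 1 - i)) where
  lt := by
    rintro s i ⟨h1, h2⟩
    have := W.lt _ _ h2
    omega
  far := by
    rintro s t i j ⟨h1, h2⟩ ⟨h3, h4⟩ hne hij
    have := W.far t s _ _ h4 h2 (Ne.symm hne) (by omega)
    omega
  intr := by
    rintro s t u i j ⟨h1, h2⟩ ⟨h3, h4⟩ hne hs ht hij
    obtain ⟨k, hk1, hk2, hk3⟩ := W.intr t s u _ _ h4 h2 (Ne.symm hne) ht hs (by omega)
    refine ⟨m - 1 - k, by omega, by omega, by omega, ?_⟩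
    rwa [show m - 1 - (m - 1 - k) = k by omega]
  occ := by
    intro s
    obtain ⟨i, hi⟩ := W.occ s
    have := W.lt _ _ hi
    refine ⟨m - 1 - i, by omega, ?_⟩
    rwa [show m - 1 - (m - 1 - i) = i by omega]

theorem CoreLab.rev {ℓ m : ℕ} {A : Fin (2 * ℓ + 4) → ℕ → Prop} {three : Bool}
    {hs : ℕ → Fin (2 * ℓ + 4)} {Lab : ℕ → CV → Prop}
    (W : Wd ℓ m A) (C : CoreLab ℓ three m (fun s i => i < m ∧ A s (m - 1 - i)) hs Lab) :
    CoreLab ℓ three m A hs (fun i w => i < m ∧ Lab (m - 1 - i) w) := by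
  have hrr : ∀ i, i < m → m - 1 - (m - 1 - i) = i := fun i hi => by omega
  have hL : ∀ i w, Lab i w → m - 1 - i < m ∧ Lab (m - 1 - (m - 1 - i)) w := by
    intro i w h
    have := C.dom i w h
    refine ⟨by omega, ?_⟩
    rwa [hrr i this]
  have hS : ∀ i u v, Lab i u → Lab (i + 1) v → m - 1 - (i + 1) < m ∧ m - 1 - (i + 1) + 1 < m ∧
      Lab (m - 1 - (m - 1 - (i + 1))) v ∧ Lab (m - 1 - (m - 1 - (i + 1) + 1)) u := by
    intro i u v h h'
    have := C.dom _ _ h'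
    refine ⟨by omega, by omega, ?_, ?_⟩
    · rwa [hrr _ this]
    · rwa [show m - 1 - (m - 1 - (i + 1) + 1) = i by omega]
  refine ⟨C.inj, C.top, fun i w h => h.1, fun i w w' h h' => C.fn _ _ _ h.2 h'.2,
    fun i w h => C.core _ _ h.2, ?_, ?_, ?_, ?_, ?_, ?_⟩
  · intro w h1 h2
    rcases C.ne w h1 h2 with h | ⟨i, h⟩
    · exact Or.inl h
    · exact Or.inr ⟨_, hL i w h⟩
  · rintro i j k w ⟨h1, h2⟩ ⟨h3, h4⟩ h5 h6
    exact ⟨by omega, C.conv _ _ _ w h4 h2 (by omega) (by omega)⟩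
  · rintro i w s ⟨h1, h2⟩ h3
    obtain ⟨j, h4, h5, h6⟩ := C.own _ w s h2 h3
    exact ⟨m - 1 - j, hL _ _ h4, h6⟩
  · rintro i u v ⟨h1, h2⟩ ⟨h3, h4⟩
    have := C.step (m - 1 - (i + 1)) v u h4 (by rwa [show m - 1 - (i + 1) + 1 = m - 1 - i by omega])
    rcases this with h | h | h
    · exact Or.inl h.symm
    · exact Or.inr (Or.inr h)
    · exact Or.inr (Or.inl h)
  · rintro i u w s ⟨h1, h2⟩ h3 h4
    exact C.star _ u w s h2 h3 ⟨by omega, by rwa [hrr i h1]⟩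
  · intro u v h1 h2 h3 h4
    rcases C.real u v h1 h2 h3 h4 with ⟨i, h, h'⟩ | ⟨i, h, h'⟩ | ⟨i, s, h, h', h''⟩ | ⟨i, s, h, h', h''⟩
    · obtain ⟨a1, a2, a3, a4⟩ := hS i u v h h'
      exact Or.inr (Or.inl ⟨_, ⟨a1, a3⟩, ⟨a2, a4⟩⟩)
    · obtain ⟨a1, a2, a3, a4⟩ := hS i v u h h'
      exact Or.inl ⟨_, ⟨a1, a3⟩, ⟨a2, a4⟩⟩
    · exact Or.inr (Or.inr (Or.inl ⟨_, s, hL _ _ h, h', h''.2⟩))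
    · exact Or.inr (Or.inr (Or.inr ⟨_, s, hL _ _ h, h', h''.2⟩))

theorem core2' {ℓ m : ℕ} (hℓ : 2 ≤ ℓ) {A : Fin (2 * ℓ + 4) → ℕ → Prop} (W : Wd ℓ m A) :
    ∃ hs Lab, CoreLab ℓ false m A hs Lab := by
  -- closest pair of distinct small letters
  have hex : ∃ d p q : ℕ, ∃ c e : Fin (2 * ℓ + 4), A c p ∧ A e q ∧ p + d = q ∧ c ≠ e ∧
      c.val ≤ ℓ + 2 ∧ e.val ≤ ℓ + 2 := by
    obtain ⟨i, hi⟩ := W.occ ⟨0, by omega⟩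
    obtain ⟨j, hj⟩ := W.occ ⟨1, by omega⟩
    rcases le_total i j with h | h
    · exact ⟨j - i, i, j, _, _, hi, hj, by omega, by simp, by simp, by simp⟩
    · exact ⟨i - j, j, i, _, _, hj, hi, by omega, by simp, by simp, by simp⟩
  obtain ⟨d, ⟨p, q, c, e, hc, he, hpq, hce, hcv, hev⟩, hmin⟩ := exists_min hex
  have hlt : p < q := by
    have := W.far c e p q hc he hce (by omega)
    omega
  have hmid : ∀ i t, p < i → i < q → A t i → ℓ + 2 < t.val := by
    intro i t h1 h2 ht
    by_contra hle
    by_cases h : t = c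
    · subst h
      have := hmin (q - i) ⟨i, q, t, e, ht, he, by omega, hce, hcv, hev⟩
      omega
    · have := hmin (i - p) ⟨p, i, c, t, hc, ht, by omega, Ne.symm h, hcv, by omega⟩
      omega
  obtain ⟨b, hbv, hbc, hbe⟩ : ∃ b : Fin (2 * ℓ + 4), b.val ≤ ℓ + 2 ∧ b ≠ c ∧ b ≠ e := by
    by_contra hno
    push Not at hno
    have h0 := hno ⟨0, by omega⟩ (by simp)
    have h1 := hno ⟨1, by omega⟩ (by simp)
    have h2 := hno ⟨2, by omega⟩ (by simp)
    simp only [ne_eq, Fin.ext_iff] at h0 h1 h2 hce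
    omega
  obtain ⟨z, hz⟩ := W.occ b
  rcases lt_trichotomy z p with h | h | h
  · obtain ⟨hs, Lab, C⟩ := core2 hℓ W.rev e c b (m - 1 - q) (m - 1 - p) (m - 1 - z)
      (by have := W.lt _ _ he; exact ⟨by omega, by rwa [show m - 1 - (m - 1 - q) = q by omega]⟩)
      (by have := W.lt _ _ hc; exact ⟨by omega, by rwa [show m - 1 - (m - 1 - p) = p by omega]⟩)
      (by have := W.lt _ _ hz; exact ⟨by omega, by rwa [show m - 1 - (m - 1 - z) = z by omega]⟩)
      (by have := W.lt _ _ he; omega) (by have := W.lt _ _ hc; omega) hce.symm hbe hbc hev hcv hbv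
      (by
        rintro i t h1 h2 ⟨h3, h4⟩
        have := W.lt _ _ h4
        exact hmid _ t (by omega) (by omega) h4)
    exact ⟨hs, _, C.rev W⟩
  · subst h
    have := W.far b c z z hz hc hbc le_rfl
    omega
  · rcases lt_trichotomy z q with h' | h' | h'
    · have := hmid z b h h' hz
      omega
    · subst h'
      have := W.far b e z z hz he hbe le_rfl
      omega
    · exact core2 hℓ W c e b p q z hc he hz hlt h' hce hbc hbe hcv hev hbv hmid

def Mset {V Λ S : Type*} (σ : S → V) (g : Λ → ℕ → V) (F : Λ → ℕ → CV → Prop)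
    (Own : CV → S → Prop) (w : CV) : Set V :=
  {v | (∃ s, Own w s ∧ v = σ s) ∨ ∃ a i, F a i w ∧ v = g a i}

theorem frame {V Λ S W' : Type*} (G : SimpleGraph V) (σ : S → V) (g : Λ → ℕ → V) (m : Λ → ℕ)
    (hσi : Function.Injective σ) (hσn : ∀ s t, ¬ G.Adj (σ s) (σ t))
    (hg : ∀ a b i j, i < m a → j < m b → g a i = g b j → a = b ∧ i = j)
    (hgσ : ∀ a i s, i < m a → g a i ≠ σ s)
    (hadj : ∀ a b i j, i < m a → j < m b →
      (G.Adj (g a i) (g b j) ↔ a = b ∧ (i + 1 = j ∨ j + 1 = i)))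
    (F : Λ → ℕ → CV → Prop) (Own : CV → S → Prop) (E : CV → CV → Prop) (Val : CV → Prop)
    (hE : ∀ u v, E u v → E v u)
    (dom : ∀ a i w, F a i w → i < m a)
    (fn : ∀ a i w w', F a i w → F a i w' → w = w')
    (own1 : ∀ w s t, Own w s → Own w t → s = t)
    (own2 : ∀ w w' s, Own w s → Own w' s → w = w')
    (ne : ∀ w, Val w → (∃ s, Own w s) ∨ ∃ a i, F a i w)
    (one : ∀ a b i j w, F a i w → F b j w → a = b)
    (conv : ∀ a i j k w, F a i w → F a k w → i ≤ j → j ≤ k → F a j w)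
    (own : ∀ a i w s, F a i w → Own w s → ∃ j, F a j w ∧ G.Adj (σ s) (g a j))
    (step : ∀ a i u v, F a i u → F a (i + 1) v → u = v ∨ E u v)
    (star : ∀ a i u w s, F a i u → Own w s → G.Adj (σ s) (g a i) → u = w ∨ E u w)
    (real : ∀ u v, Val u → Val v → E u v →
      ∃ x ∈ Mset σ g F Own u, ∃ y ∈ Mset σ g F Own v, G.Adj x y)
    (H : SimpleGraph W') (φ : W' → CV) (hφ : Function.Injective φ) (hval : ∀ w, Val (φ w))
    (hH : ∀ a b, a ≠ b → (H.Adj a b ↔ E (φ a) (φ b))) : InducedMinor H G := by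
  refine ⟨fun w => Mset σ g F Own (φ w), ?_, ?_, ?_, ?_⟩
  · intro w
    rcases ne _ (hval w) with ⟨s, h⟩ | ⟨a, i, h⟩
    · exact ⟨σ s, Or.inl ⟨s, h, rfl⟩⟩
    · exact ⟨g a i, Or.inr ⟨a, i, h, rfl⟩⟩
  · intro w
    have key : ∀ a d i (h : F a i (φ w)) (h' : F a (i + d) (φ w)),
        (G.induce (Mset σ g F Own (φ w))).Reachable
          ⟨g a i, Or.inr ⟨a, i, h, rfl⟩⟩ ⟨g a (i + d), Or.inr ⟨a, i + d, h', rfl⟩⟩ := by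
      intro a d
      induction d with
      | zero => intro i h h'; exact SimpleGraph.Reachable.refl _
      | succ d ih =>
        intro i h h'
        have h2 : F a (i + d) (φ w) := conv a i (i + d) (i + (d + 1)) _ h h' (by omega) (by omega)
        refine (ih i h h2).trans (SimpleGraph.Adj.reachable ?_)
        rw [SimpleGraph.comap_adj]
        exact (hadj a a _ _ (dom _ _ _ h2) (dom _ _ _ h')).2 ⟨rfl, Or.inl (by omega)⟩
    have key2 : ∀ a i j (h : F a i (φ w)) (h' : F a j (φ w)),
        (G.induce (Mset σ g F Own (φ w))).Reachable
          ⟨g a i, Or.inr ⟨a, i, h, rfl⟩⟩ ⟨g a j, Or.inr ⟨a, j, h', rfl⟩⟩ := by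
      intro a i j h h'
      rcases le_total i j with hij | hij
      · obtain ⟨d, rfl⟩ := Nat.exists_eq_add_of_le hij
        exact key a d i h h'
      · obtain ⟨d, rfl⟩ := Nat.exists_eq_add_of_le hij
        exact (key a d j h' h).symm
    rw [SimpleGraph.connected_iff_exists_forall_reachable]
    by_cases ho : ∃ s, Own (φ w) s
    · obtain ⟨s, hs⟩ := ho
      refine ⟨⟨σ s, Or.inl ⟨s, hs, rfl⟩⟩, ?_⟩
      rintro ⟨v, ⟨t, ht, rfl⟩ | ⟨a, i, hi, rfl⟩⟩
      · have := own1 _ _ _ hs ht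
        subst this
        exact SimpleGraph.Reachable.refl _
      · obtain ⟨j, hj, hja⟩ := own a i _ s hi hs
        refine SimpleGraph.Reachable.trans (SimpleGraph.Adj.reachable
          (v := ⟨g a j, Or.inr ⟨a, j, hj, rfl⟩⟩) ?_) (key2 a j i hj hi)
        rw [SimpleGraph.comap_adj]
        exact hja
    · rcases ne _ (hval w) with h | ⟨a, i, h⟩
      · exact absurd h ho
      · refine ⟨⟨g a i, Or.inr ⟨a, i, h, rfl⟩⟩, ?_⟩
        rintro ⟨v, ⟨t, ht, rfl⟩ | ⟨b, j, hj, rfl⟩⟩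
        · exact absurd ⟨t, ht⟩ ho
        · have := one _ _ _ _ _ h hj
          subst this
          exact key2 a i j h hj
  · intro u v huv
    rw [Set.disjoint_left]
    rintro x (⟨s, hs, rfl⟩ | ⟨a, i, hi, rfl⟩) (⟨t, ht, h⟩ | ⟨b, j, hj, h⟩)
    · have := hσi h
      subst this
      exact huv (hφ (own2 _ _ _ hs ht))
    · exact hgσ _ _ _ (dom _ _ _ hj) h.symm
    · exact hgσ _ _ _ (dom _ _ _ hi) h
    · obtain ⟨rfl, rfl⟩ := hg _ _ _ _ (dom _ _ _ hi) (dom _ _ _ hj) h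
      exact huv (hφ (fn _ _ _ _ hi hj))
  · intro u v huv
    have hne : φ u ≠ φ v := fun h => huv (hφ h)
    rw [hH u v huv]
    constructor
    · rintro ⟨x, (⟨s, hs, rfl⟩ | ⟨a, i, hi, rfl⟩), y, (⟨t, ht, rfl⟩ | ⟨b, j, hj, rfl⟩), h⟩
      · exact absurd h (hσn _ _)
      · rcases star _ _ _ _ _ hj hs h with h | h
        · exact absurd h.symm hne
        · exact hE _ _ h
      · rcases star _ _ _ _ _ hi ht h.symm with h | h
        · exact absurd h hne
        · exact h
      · obtain ⟨rfl, h | h⟩ := (hadj _ _ _ _ (dom _ _ _ hi) (dom _ _ _ hj)).1 h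
        · subst h
          exact (step _ _ _ _ hi hj).resolve_left hne
        · subst h
          exact hE _ _ ((step _ _ _ _ hj hi).resolve_left hne.symm)
    · exact fun h => real _ _ (hval u) (hval v) h

theorem BA_arm {ℓ : ℕ} {three : Bool} {w : CV} {u k j : ℕ} (h : BA ℓ three w (.arm u k j)) :
    (∃ i, w = .arm u k i ∧ i + 1 = j) ∨ (j = ℓ ∧ w = csite ℓ u) := by
  cases w <;> simp_all [BA]

theorem csite_not_arm (ℓ u : ℕ) : ¬ IsArm (csite ℓ u) := by
  unfold csite
  split_ifs <;> simp [IsArm]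

theorem BA_site {ℓ : ℕ} {three : Bool} (u k : ℕ) : BA ℓ three (csite ℓ u) (.arm u k ℓ) := by
  have := csite_not_arm ℓ u
  cases h : csite ℓ u <;> simp_all [BA, IsArm]

theorem COwn_not_arm {ℓ : ℕ} {three : Bool} {hs : ℕ → Fin (2 * ℓ + 4)} {w : CV}
    {s : Fin (2 * ℓ + 4)} (h : COwn ℓ three hs w s) : ¬ IsArm w := by
  rcases h with ⟨u, _, rfl, _⟩ | ⟨_, rfl, _⟩
  · exact csite_not_arm _ _
  · simp [IsArm]

/-- concrete data extracted from the constellation -/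
structure Sys {V : Type*} (G : SimpleGraph V) (ℓ : ℕ) (σ : Fin (2 * ℓ + 4) → V)
    (g : Option (Fin (2 * ℓ + 3) × Fin ℓ) → ℕ → V)
    (m : Option (Fin (2 * ℓ + 3) × Fin ℓ) → ℕ) : Prop where
  hσi : Function.Injective σ
  hσn : ∀ s t, ¬ G.Adj (σ s) (σ t)
  hg : ∀ a b i j, i < m a → j < m b → g a i = g b j → a = b ∧ i = j
  hgσ : ∀ a i s, i < m a → g a i ≠ σ s
  hadj : ∀ a b i j, i < m a → j < m b →
      (G.Adj (g a i) (g b j) ↔ a = b ∧ (i + 1 = j ∨ j + 1 = i))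
  wd : ∀ a, Wd ℓ (m a) (fun s i => i < m a ∧ G.Adj (σ s) (g a i))

theorem csite_ne_root {ℓ u : ℕ} : csite ℓ u ≠ .root := by
  unfold csite
  split_ifs <;> simp

theorem Sys.minor {V W' : Type*} {G : SimpleGraph V} {ℓ : ℕ} {σ : Fin (2 * ℓ + 4) → V}
    {g : Option (Fin (2 * ℓ + 3) × Fin ℓ) → ℕ → V} {m : Option (Fin (2 * ℓ + 3) × Fin ℓ) → ℕ}
    (D : Sys G ℓ σ g m) {three : Bool} {hs : ℕ → Fin (2 * ℓ + 4)} {Lab : ℕ → CV → Prop}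
    (C : CoreLab ℓ three (m none) (fun s i => i < m none ∧ G.Adj (σ s) (g none i)) hs Lab)
    (H : SimpleGraph W') (φ : W' → CV) (hφ : Function.Injective φ)
    (hval : ∀ w, CValid ℓ (φ w))
    (hH : ∀ a b, a ≠ b → (H.Adj a b ↔ BA ℓ three (φ a) (φ b) ∨ BA ℓ three (φ b) (φ a))) :
    InducedMinor H G := by
  have hrun : ∀ a : Fin (2 * ℓ + 3) × Fin ℓ, ∃ lo hi, lo ≤ hi ∧ ℓ < lo ∧ hi + ℓ + 1 < m (some a) ∧
      G.Adj (σ (hs a.1)) (g (some a) lo) ∧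
      (∀ i t, lo ≤ i + ℓ → i ≤ hi + ℓ → G.Adj (σ t) (g (some a) i) →
        t = hs a.1 ∧ lo ≤ i ∧ i ≤ hi) := by
    intro a
    obtain ⟨p, hp⟩ := (D.wd (some a)).occ (hs a.1)
    obtain ⟨lo, h1, h2, h3, h4, h5⟩ := (D.wd (some a)).leftrun hp
    obtain ⟨hi, k1, k2, k3, k4, k5⟩ := (D.wd (some a)).rightrun hp
    refine ⟨lo, hi, by omega, h2, k2, h3.2, ?_⟩
    intro i t hi1 hi2 hA
    have hA' : i < m (some a) ∧ G.Adj (σ t) (g (some a) i) := ⟨by omega, hA⟩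
    have a1 : lo ≤ i := by
      by_contra hlt
      exact h4 i t hi1 (by omega) hA'
    have a2 : i ≤ hi := by
      by_contra hlt
      exact k4 i t hi2 (by omega) hA'
    refine ⟨?_, a1, a2⟩
    rcases le_total i p with h | h
    · exact h5 i t a1 h hA'
    · exact k5 i t h a2 hA'
  choose lo hi r1 r2 r3 r4 r5 using hrun
  let F : Option (Fin (2 * ℓ + 3) × Fin ℓ) → ℕ → CV → Prop := fun a i w =>
    match a with
    | none => Lab i w
    | some a => lo a ≤ i + ℓ ∧ i ≤ hi a + ℓ ∧
        w = .arm a.1 a.2 (min (i - (lo a - ℓ)) ℓ + (i - hi a))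
  have hown2 : ∀ w w' s, COwn ℓ three hs w s → COwn ℓ three hs w' s → w = w' := by
    rintro w w' s (⟨u, hu, rfl, rfl⟩ | ⟨h1, rfl, rfl⟩) (⟨v, hv, rfl, h⟩ | ⟨h3, rfl, h⟩)
    · rw [C.inj u v hu hv h]
    · exact absurd h (C.top h3 u hu)
    · exact absurd h.symm (C.top h1 v hv)
    · rfl
  have hown1 : ∀ w s t, COwn ℓ three hs w s → COwn ℓ three hs w t → s = t := by
    rintro w s t (⟨u, hu, rfl, rfl⟩ | ⟨h1, rfl, rfl⟩) (⟨v, hv, h, rfl⟩ | ⟨h3, h, rfl⟩)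
    · rw [csite_inj hu hv h]
    · exact absurd h csite_ne_root
    · exact absurd h.symm csite_ne_root
    · rfl
  have hdir : ∀ u v, CValid ℓ u → CValid ℓ v → BA ℓ three u v →
      ∃ x ∈ Mset σ g F (COwn ℓ three hs) u, ∃ y ∈ Mset σ g F (COwn ℓ three hs) v, G.Adj x y := by
    intro u v hu hv hb
    by_cases harm : IsArm v
    · cases v with
      | arm s k j =>
        obtain ⟨hs1, hk1, hj1⟩ := hv
        set a : Fin (2 * ℓ + 3) × Fin ℓ := (⟨s, hs1⟩, ⟨k, hk1⟩) with ha
        have b1 := r1 a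
        have b2 := r2 a
        have b3 := r3 a
        rcases BA_arm hb with ⟨i, rfl, rfl⟩ | ⟨rfl, rfl⟩
        · rcases lt_or_ge i ℓ with hil | hil
          · refine ⟨g (some a) (lo a - ℓ + i), Or.inr ⟨some a, _, ⟨by omega, by omega, ?_⟩, rfl⟩,
              g (some a) (lo a - ℓ + i + 1), Or.inr ⟨some a, _, ⟨by omega, by omega, ?_⟩, rfl⟩, ?_⟩
            · congr 1; omega
            · congr 1; omega
            · rw [D.hadj _ _ _ _ (by omega) (by omega)]
              exact ⟨rfl, Or.inl rfl⟩
          · refine ⟨g (some a) (hi a + (i - ℓ)), Or.inr ⟨some a, _, ⟨by omega, by omega, ?_⟩, rfl⟩,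
              g (some a) (hi a + (i - ℓ) + 1), Or.inr ⟨some a, _, ⟨by omega, by omega, ?_⟩, rfl⟩, ?_⟩
            · congr 1; omega
            · congr 1; omega
            · rw [D.hadj _ _ _ _ (by omega) (by omega)]
              exact ⟨rfl, Or.inl rfl⟩
        · refine ⟨σ (hs s), Or.inl ⟨hs s, Or.inl ⟨s, hs1, rfl, rfl⟩, rfl⟩,
            g (some a) (lo a), Or.inr ⟨some a, _, ⟨by omega, by omega, ?_⟩, rfl⟩, r4 a⟩
          congr 1; omega
      | _ => exact absurd harm (by simp [IsArm])
    · rcases C.real u v hu hv harm hb with ⟨i, h, h'⟩ | ⟨i, h, h'⟩ | ⟨i, s, h, h', h''⟩ |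
        ⟨i, s, h, h', h''⟩
      · exact ⟨_, Or.inr ⟨none, i, h, rfl⟩, _, Or.inr ⟨none, i + 1, h', rfl⟩,
          (D.hadj _ _ _ _ (C.dom _ _ h) (C.dom _ _ h')).2 ⟨rfl, Or.inl rfl⟩⟩
      · exact ⟨_, Or.inr ⟨none, i + 1, h', rfl⟩, _, Or.inr ⟨none, i, h, rfl⟩,
          (D.hadj _ _ _ _ (C.dom _ _ h') (C.dom _ _ h)).2 ⟨rfl, Or.inr rfl⟩⟩
      · exact ⟨_, Or.inr ⟨none, i, h, rfl⟩, _, Or.inl ⟨s, h', rfl⟩, h''.2.symm⟩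
      · exact ⟨_, Or.inl ⟨s, h', rfl⟩, _, Or.inr ⟨none, i, h, rfl⟩, h''.2⟩
  refine frame G σ g m D.hσi D.hσn D.hg D.hgσ D.hadj F (COwn ℓ three hs)
    (fun u v => BA ℓ three u v ∨ BA ℓ three v u) (CValid ℓ) (fun u v h => h.symm) ?_ ?_
    hown1 hown2 ?_ ?_ ?_ ?_ ?_ ?_ ?_ H φ hφ hval hH
  · rintro (_ | a) i w h
    · exact C.dom _ _ h
    · have := r3 a
      have := h.2.1
      omega
  · rintro (_ | a) i w w' h h'
    · exact C.fn _ _ _ h h'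
    · rw [h.2.2, h'.2.2]
  · intro w hw
    by_cases harm : IsArm w
    · cases w with
      | arm s k j =>
        obtain ⟨hs1, hk1, hj1⟩ := hw
        set a : Fin (2 * ℓ + 3) × Fin ℓ := (⟨s, hs1⟩, ⟨k, hk1⟩) with ha
        have b1 := r1 a
        have b2 := r2 a
        right
        rcases lt_or_ge j ℓ with hil | hil
        · exact ⟨some a, lo a - ℓ + j, by omega, by omega, by congr 1; omega⟩
        · exact ⟨some a, hi a + (j - ℓ), by omega, by omega, by congr 1; omega⟩
      | _ => exact absurd harm (by simp [IsArm])
    · rcases C.ne w hw harm with h | ⟨i, h⟩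
      · exact Or.inl h
      · exact Or.inr ⟨none, i, h⟩
  · rintro (_ | a) (_ | b) i j w h h'
    · rfl
    · exact absurd (by rw [h'.2.2]; trivial) (C.core _ _ h)
    · exact absurd (by rw [h.2.2]; trivial) (C.core _ _ h')
    · have := h.2.2.symm.trans h'.2.2
      simp only [CV.arm.injEq] at this
      rw [Option.some_inj]
      exact Prod.ext (Fin.ext this.1) (Fin.ext this.2.1)
  · rintro (_ | a) i j k w h h' h1 h2
    · exact C.conv _ _ _ _ h h' h1 h2
    · obtain ⟨c1, c2, c3⟩ := h
      obtain ⟨d1, d2, d3⟩ := h'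
      refine ⟨by omega, by omega, ?_⟩
      rw [c3] at d3 ⊢
      simp only [CV.arm.injEq, true_and] at d3
      congr 1
      have := r1 a
      have := r2 a
      omega
  · rintro (_ | a) i w s h h'
    · obtain ⟨j, h1, h2⟩ := C.own i w s h h'
      exact ⟨j, h1, h2.2⟩
    · exact absurd (by rw [h.2.2]; trivial) (COwn_not_arm h')
  · rintro (_ | a) i u v h h'
    · exact C.step _ _ _ h h'
    · obtain ⟨c1, c2, c3⟩ := h
      obtain ⟨d1, d2, d3⟩ := h'
      have := r1 a
      have := r2 a
      have hh : (min (i + 1 - (lo a - ℓ)) ℓ + (i + 1 - hi a)) = min (i - (lo a - ℓ)) ℓ + (i - hi a) ∨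
        (min (i - (lo a - ℓ)) ℓ + (i - hi a)) + 1 = min (i + 1 - (lo a - ℓ)) ℓ + (i + 1 - hi a) := by
        omega
      rcases hh with hh | hh
      · left; rw [c3, d3, hh]
      · right; left; rw [c3, d3]
        exact ⟨rfl, rfl, hh⟩
  · rintro (_ | a) i u w s h h' hA
    · exact C.star _ _ _ _ h h' ⟨C.dom _ _ h, hA⟩
    · obtain ⟨c1, c2, c3⟩ := h
      obtain ⟨e1, e2, e3⟩ := r5 a i s c1 c2 hA
      right; right
      rw [c3, hown2 w (csite ℓ a.1) s h' (Or.inl ⟨_, a.1.isLt, rfl, e1⟩)]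
      have := r1 a
      have := r2 a
      rw [show min (i - (lo a - ℓ)) ℓ + (i - hi a) = ℓ by omega]
      exact BA_site _ _
  · rintro u v hu hv (h | h)
    · exact hdir u v hu hv h
    · obtain ⟨x, hx, y, hy, hxy⟩ := hdir v u hv hu h
      exact ⟨y, hy, x, hx, hxy.symm⟩

def phiT (ℓ : ℕ) : TVert ℓ → CV
  | Sum.inl _ => .root
  | Sum.inr (Sum.inl i) => .leaf i
  | Sum.inr (Sum.inr (Sum.inl p)) => if p.1 = 0 then .x p.2 else .y p.2
  | Sum.inr (Sum.inr (Sum.inr (Sum.inl p))) => .pd p.1 p.2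
  | Sum.inr (Sum.inr (Sum.inr (Sum.inr p))) => .arm p.1 p.2.1 p.2.2

def phiU (ℓ : ℕ) : TVert ℓ ⊕ Fin ℓ × (Unit ⊕ Fin ℓ × Fin (2 * ℓ + 1)) → CV
  | Sum.inl t => phiT ℓ t
  | Sum.inr (i, Sum.inl _) => .free i
  | Sum.inr (i, Sum.inr p) => .arm (ℓ + 3 + i) p.1 p.2

theorem phiT_inj (ℓ : ℕ) : Function.Injective (phiT ℓ) := by
  rintro (_ | i | ⟨p, j⟩ | ⟨p, j⟩ | ⟨u, k, j⟩) (_ | i' | ⟨p', j'⟩ | ⟨p', j'⟩ | ⟨u', k', j'⟩) h <;>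
    simp only [phiT] at h <;> (try split_ifs at h) <;>
    (try simp only [reduceCtorEq, CV.leaf.injEq, CV.x.injEq, CV.y.injEq, CV.pd.injEq, CV.arm.injEq,
      Fin.val_inj] at h)
  · rfl
  · rw [h]
  · simp_all
  · have : p = p' := by omega
    rw [this, h]
  · rw [h.1, h.2]
  · rw [h.1, h.2.1, h.2.2]

theorem phiU_inj (ℓ : ℕ) : Function.Injective (phiU ℓ) := by
  rintro (t | ⟨i, _ | ⟨k, j⟩⟩) (t' | ⟨i', _ | ⟨k', j'⟩⟩) h
  · rw [phiT_inj ℓ h]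
  · exfalso
    rcases t with _ | i | ⟨p, j⟩ | ⟨p, j⟩ | ⟨u, k, j⟩ <;> simp only [phiU, phiT] at h <;>
      (try split_ifs at h) <;> simp at h
  · exfalso
    rcases t with _ | i | ⟨p, j⟩ | ⟨p, j⟩ | ⟨u, k, j⟩ <;> simp only [phiU, phiT] at h <;>
      (try split_ifs at h) <;> simp at h
    have := u.isLt
    omega
  · exfalso
    rcases t' with _ | i | ⟨p, j⟩ | ⟨p, j⟩ | ⟨u, k, j⟩ <;> simp only [phiU, phiT] at h <;>
      (try split_ifs at h) <;> simp at h
  · simp only [phiU, CV.free.injEq, Fin.val_inj] at h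
    rw [h]
  · simp [phiU] at h
  · exfalso
    rcases t' with _ | i | ⟨p, j⟩ | ⟨p, j⟩ | ⟨u, k, j⟩ <;> simp only [phiU, phiT] at h <;>
      (try split_ifs at h) <;> simp at h
    have := u.isLt
    omega
  · simp [phiU] at h
  · simp only [phiU, CV.arm.injEq, Fin.val_inj, add_right_inj] at h
    rw [h.1, h.2.1, h.2.2]

theorem phiU_val (ℓ : ℕ) (w) : CValid ℓ (phiU ℓ w) := by
  rcases w with (_ | i | ⟨p, j⟩ | ⟨p, j⟩ | ⟨u, k, j⟩) | ⟨i, _ | ⟨k, j⟩⟩ <;>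
    simp only [phiU, phiT, CValid] <;> (try split_ifs) <;> (try simp only [CValid]) <;> omega

theorem phi_site (ℓ : ℕ) (u : Fin (ℓ + 3)) : phiT ℓ (glueSite ℓ u) = csite ℓ u := by
  unfold glueSite csite
  by_cases h3 : 3 ≤ (u : ℕ)
  · have := u.isLt
    rw [dif_pos h3, if_neg (by omega), if_neg (by omega), if_neg (by omega), if_pos (by omega)]
    rfl
  · rw [dif_neg h3]
    by_cases h0 : (u : ℕ) = 0
    · rw [if_pos h0, if_pos h0]; rfl
    rw [if_neg h0, if_neg h0]
    by_cases h1 : (u : ℕ) = 1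
    · rw [if_pos h1, if_pos h1]; rfl
    rw [if_neg h1, if_neg h1, if_pos (by omega)]; rfl

theorem phi_att (ℓ : ℕ) (three : Bool) (p : Fin 3) :
    phiT ℓ (attachPt ℓ three p) = catt ℓ three p := by
  unfold attachPt catt
  split_ifs <;> rfl

theorem phi_TAdj (ℓ : ℕ) (three : Bool) (a b : TVert ℓ) :
    TAdj ℓ three a b ↔ BA ℓ three (phiT ℓ a) (phiT ℓ b) := by
  have hs : ∀ u : Fin (ℓ + 3), a = glueSite ℓ u ↔ phiT ℓ a = csite ℓ u := fun u => by
    rw [← phi_site, (phiT_inj ℓ).eq_iff]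
  have ht : ∀ p : Fin 3, a = attachPt ℓ three p ↔ phiT ℓ a = catt ℓ three p := fun p => by
    rw [← phi_att, (phiT_inj ℓ).eq_iff]
  rcases a with (_ | i | ⟨p, j⟩ | ⟨p, j⟩ | ⟨u, k, j⟩) <;>
    rcases b with (_ | i' | ⟨p', j'⟩ | ⟨p', j'⟩ | ⟨u', k', j'⟩) <;>
    simp only [TAdj, hs, ht] <;> simp only [phiT, Fin.val_inj] <;> (try split_ifs) <;>
    simp only [BA, Fin.val_inj] <;> (try (simp_all; done))
  · refine iff_of_false ?_ id
    rintro ⟨rfl, -⟩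
    contradiction
  · omega

theorem phi_T1 (ℓ : ℕ) (three : Bool) (i : Fin ℓ) (a b : Unit ⊕ Fin ℓ × Fin (2 * ℓ + 1)) (i' : Fin ℓ) :
    (i = i' ∧ (T1Graph ℓ).Adj a b) ↔
      (BA ℓ three (phiU ℓ (Sum.inr (i, a))) (phiU ℓ (Sum.inr (i', b))) ∨
       BA ℓ three (phiU ℓ (Sum.inr (i', b))) (phiU ℓ (Sum.inr (i, a)))) := by
  have hc : ∀ i : Fin ℓ, csite ℓ (ℓ + 3 + i) = .free i := by
    intro i
    rw [csite, if_neg (by omega), if_neg (by omega), if_neg (by omega), if_neg (by omega)]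
    congr 1; omega
  rcases a with _ | ⟨k, j⟩ <;> rcases b with _ | ⟨k', j'⟩ <;>
    simp only [T1Graph, SimpleGraph.fromRel_adj, phiU, BA, hc, CV.free.injEq, Fin.val_inj,
      add_right_inj, ne_eq, Sum.inr.injEq, Prod.mk.injEq, not_false_eq_true, reduceCtorEq]
  · simp
  · simp; tauto
  · simp; tauto
  · simp only [Fin.ext_iff]; omega

theorem BA_mix (ℓ : ℕ) (three : Bool) (t : TVert ℓ) (i : Fin ℓ) (b : Unit ⊕ Fin ℓ × Fin (2 * ℓ + 1)) :
    ¬ (BA ℓ three (phiT ℓ t) (phiU ℓ (Sum.inr (i, b))) ∨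
       BA ℓ three (phiU ℓ (Sum.inr (i, b))) (phiT ℓ t)) := by
  have hc : csite ℓ (ℓ + 3 + i) = .free i := by
    rw [csite, if_neg (by omega), if_neg (by omega), if_neg (by omega), if_neg (by omega)]
    congr 1; omega
  have hd : ∀ u : Fin (ℓ + 3), ∀ i, csite ℓ u ≠ .free i := by
    intro u i
    have := u.isLt
    unfold csite
    split_ifs <;> simp
  have he : ∀ p i, catt ℓ three p ≠ .free i := by
    intro u i
    unfold catt
    split_ifs <;> simp
  rcases t with (_ | i' | ⟨p, j⟩ | ⟨p, j⟩ | ⟨u, k, j⟩) <;> rcases b with _ | ⟨k', j'⟩ <;>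
    simp only [phiU, phiT] <;> (try split_ifs) <;> simp only [BA, hc, reduceCtorEq, and_false, or_false, not_false_eq_true]
  · rintro (h | h)
    · exact h
    · exact he _ _ h.2.symm
  · rintro (h | h)
    · exact h
    · have := h.2
      unfold catt at this
      split_ifs at this
  · rintro (h | h)
    · exact h
    · exact hd _ _ h.2.symm
  · have := u.isLt
    omega

theorem phi_union (ℓ : ℕ) (three : Bool) (a b) (hab : a ≠ b) :
    (disjUnion (SimpleGraph.fromRel (TAdj ℓ three)) (copies ℓ (T1Graph ℓ))).Adj a b ↔
      BA ℓ three (phiU ℓ a) (phiU ℓ b) ∨ BA ℓ three (phiU ℓ b) (phiU ℓ a) := by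
  rcases a with t | ⟨i, a⟩ <;> rcases b with t' | ⟨i', b⟩
  · have hne : t ≠ t' := fun h => hab (by rw [h])
    simp only [disjUnion, SimpleGraph.fromRel_adj, phiU, ← phi_TAdj]
    tauto
  · have := BA_mix ℓ three t i' b
    simp only [disjUnion, SimpleGraph.fromRel_adj, ne_eq, or_self, and_false, false_iff]
    exact this
  · have := BA_mix ℓ three t' i a
    simp only [disjUnion, SimpleGraph.fromRel_adj, ne_eq, or_self, and_false, false_iff]
    exact fun h => this h.symm
  · rw [← phi_T1]
    have hne : (i, a) ≠ (i', b) := fun h => hab (by rw [h])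
    have h1 := (T1Graph ℓ).adj_comm a b
    have h2 : i = i' ↔ i' = i := eq_comm
    simp only [disjUnion, copies, SimpleGraph.fromRel_adj]
    tauto

theorem exists_sigma {V : Type*} (S : Set V) (n : ℕ) (hf : S.Finite) (hn : S.ncard = n)
    (r : V → V → Prop) (hr : StrictTotalOrderOn S r) :
    ∃ σ : Fin n → V, Function.Injective σ ∧ (∀ i, σ i ∈ S) ∧
      (∀ v ∈ S, ∃ i, σ i = v) ∧ ∀ i j, i < j → r (σ i) (σ j) := by
  classical
  obtain ⟨h1, h2, h3⟩ := hr
  let r' : S → S → Prop := fun a b => r a b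
  have : Std.Irrefl r' := ⟨fun a => h1 a a.2⟩
  have : IsTrans S r' := ⟨fun a b c => h2 a a.2 b b.2 c c.2⟩
  have : Std.Trichotomous r' := ⟨fun a b hab hba => by
    by_contra hne
    rcases h3 a a.2 b b.2 (fun h => hne (Subtype.ext h)) with h | h
    · exact hab h
    · exact hba h⟩
  have : IsStrictTotalOrder S r' := {}
  letI : LinearOrder S := linearOrderOfSTO r'
  have : Fintype S := hf.fintype
  have hc : Fintype.card S = n := by rw [← hn, ← Nat.card_coe_set_eq, Nat.card_eq_fintype_card]
  let e := Fintype.orderIsoFinOfCardEq S hc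
  refine ⟨fun i => (e i : V), ?_, fun i => (e i).2, ?_, ?_⟩
  · intro i j h
    exact e.injective (Subtype.ext h)
  · intro v hv
    exact ⟨e.symm ⟨v, hv⟩, by simp⟩
  · intro i j h
    have : e i < e j := e.lt_iff_lt.2 h
    exact this

theorem path_data {U : Type*} (G : SimpleGraph U) (h : IsPathGraph G) [Nonempty U] :
    ∃ (n : ℕ) (g : ℕ → U), (∀ v, ∃ i < n, g i = v) ∧
      (∀ i j, i < n → j < n → g i = g j → i = j) ∧
      (∀ i j, i < n → j < n → (G.Adj (g i) (g j) ↔ i + 1 = j ∨ j + 1 = i)) := by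
  classical
  obtain ⟨n, ⟨e⟩⟩ := h
  refine ⟨n, fun i => if h : i < n then e.symm ⟨i, h⟩ else Classical.arbitrary U, ?_, ?_, ?_⟩
  · intro v
    refine ⟨e v, (e v).isLt, ?_⟩
    simp
  · intro i j hi hj h
    simp only [hi, hj, dif_pos] at h
    simpa using e.symm.injective h
  · intro i j hi hj
    simp only [hi, hj, dif_pos]
    rw [e.symm.map_adj_iff, SimpleGraph.pathGraph_adj]

theorem walk_seg {U : Type*} (G : SimpleGraph U) (g : ℕ → U) (d : ℕ) : ∀ i,
    (∀ k, i ≤ k → k < i + d → G.Adj (g k) (g (k + 1))) →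
    ∃ w : G.Walk (g i) (g (i + d)), w.length = d ∧ w.support = (List.range' i (d + 1)).map g := by
  induction d with
  | zero => intro i _; exact ⟨SimpleGraph.Walk.nil, rfl, rfl⟩
  | succ d ih =>
    intro i h
    obtain ⟨w, h1, h2⟩ := ih (i + 1) (fun k h1 h2 => h k (by omega) (by omega))
    have e : i + 1 + d = i + (d + 1) := by omega
    refine ⟨SimpleGraph.Walk.cons (h i le_rfl (by omega)) (w.copy rfl (by rw [e])), ?_, ?_⟩
    · simp [h1]
    · rw [SimpleGraph.Walk.support_cons, SimpleGraph.Walk.support_copy, h2, List.range'_succ (n := d + 1)]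
      rfl

theorem route_rev {V : Type*} {G : SimpleGraph V} {S : Set V} {x y : V} {p : G.Walk x y}
    (h : IsRoute G S x y p) : IsRoute G S y x p.reverse := by
  obtain ⟨h1, h2, h3, h4, h5⟩ := h
  refine ⟨h2, h1, h3.reverse, by simpa using h4, ?_⟩
  intro v hv hy hx
  exact h5 v (by simpa using hv) hx hy

theorem path_wd {V : Type*} {G : SimpleGraph V} {SC : Set V} {LC : Set (Set V)} {ℓ : ℕ}
    (hC : IsConstellation G SC LC) (hA : IsAmpleStrong G SC LC (ℓ + 1))
    (σ : Fin (2 * ℓ + 4) → V) (hσi : Function.Injective σ) (hσ : ∀ s, σ s ∈ SC)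
    (hint : ∀ s t u, s < t → t < u → ∀ p : G.Walk (σ s) (σ t), IsRoute G SC (σ s) (σ t) p →
      ∃ v ∈ p.support, G.Adj (σ u) v)
    (P : Set V) (hP : P ∈ LC) (n : ℕ) (g : ℕ → P) (hsur : ∀ v, ∃ i < n, g i = v)
    (hinj : ∀ i j, i < n → j < n → g i = g j → i = j)
    (hadj : ∀ i j, i < n → j < n → ((G.induce P).Adj (g i) (g j) ↔ i + 1 = j ∨ j + 1 = i)) :
    Wd ℓ n (fun s i => i < n ∧ G.Adj (σ s) (g i)) := by
  have hoff : ∀ i, (g i : V) ∉ SC := fun i h =>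
    Set.disjoint_left.1 (hC.pathsOffS P hP) (g i).2 h
  have hroute : ∀ s t i j, s ≠ t → i ≤ j → i < n → j < n → G.Adj (σ s) (g i) → G.Adj (σ t) (g j) →
      ∃ p : G.Walk (σ s) (σ t), IsRoute G SC (σ s) (σ t) p ∧ p.length = j - i + 2 ∧
        ∀ v ∈ p.support, v = σ s ∨ v = σ t ∨ ∃ k, i ≤ k ∧ k ≤ j ∧ v = g k := by
    intro s t i j hst hij hin hjn hsi htj
    obtain ⟨d, rfl⟩ := Nat.exists_eq_add_of_le hij
    obtain ⟨w, hw1, hw2⟩ := walk_seg G (fun k => (g k : V)) d i (fun k h1 h2 =>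
      (hadj k (k + 1) (by omega) (by omega)).2 (Or.inl rfl))
    have hsup : (SimpleGraph.Walk.cons hsi (w.concat htj.symm)).support
        = σ s :: ((List.range' i (d + 1)).map (fun k => (g k : V)) ++ [σ t]) := by
      rw [SimpleGraph.Walk.support_cons, SimpleGraph.Walk.support_concat, hw2]
      try simp
    have hmem : ∀ v ∈ (SimpleGraph.Walk.cons hsi (w.concat htj.symm)).support,
        v = σ s ∨ v = σ t ∨ ∃ k, i ≤ k ∧ k ≤ i + d ∧ v = g k := by
      intro v hv
      rw [hsup, List.mem_cons, List.mem_append, List.mem_singleton, List.mem_map] at hv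
      rcases hv with h | ⟨k, hk, h⟩ | h
      · exact Or.inl h
      · rw [List.mem_range'_1] at hk
        exact Or.inr (Or.inr ⟨k, by omega, by omega, h.symm⟩)
      · exact Or.inr (Or.inl h)
    refine ⟨_, ⟨hσ s, hσ t, ?_, by simp, ?_⟩, by simp [hw1], hmem⟩
    · rw [SimpleGraph.Walk.isPath_def, hsup, List.nodup_cons, List.nodup_append]
      refine ⟨?_, ?_, List.nodup_singleton _, ?_⟩
      · rw [List.mem_append, List.mem_singleton, List.mem_map]
        rintro (⟨k, _, h⟩ | h)
        · exact hoff k (h ▸ hσ s)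
        · exact hst (hσi h)
      · refine List.Nodup.map_on ?_ (List.nodup_range')
        intro a ha b hb h
        rw [List.mem_range'_1] at ha hb
        exact hinj a b (by omega) (by omega) (Subtype.ext h)
      · intro a ha b hb h
        rw [List.mem_singleton] at hb
        rw [List.mem_map] at ha
        obtain ⟨k, _, hk⟩ := ha
        exact hoff k (by rw [hk, h, hb]; exact hσ t)
    · intro v hv h1 h2
      rcases hmem v hv with h | h | ⟨k, _, _, h⟩
      · exact absurd h h1
      · exact absurd h h2
      · rw [h]; exact hoff k
  have hfar : ∀ s t i j, (i < n ∧ G.Adj (σ s) (g i)) → (j < n ∧ G.Adj (σ t) (g j)) → s ≠ t → i ≤ j →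
      i + ℓ + 1 ≤ j := by
    rintro s t i j ⟨h1, h2⟩ ⟨h3, h4⟩ hne hij
    obtain ⟨p, hp, hl, _⟩ := hroute s t i j hne hij h1 h3 h2 h4
    have := hA.1 _ _ p hp
    omega
  refine ⟨?_, hfar, ?_, ?_⟩
  · rintro s i ⟨hi, hsi⟩
    have hstep : ∀ k, k + 1 < n → (G.induce P).Adj (g k) (g (k + 1)) := fun k hk =>
      (hadj k (k + 1) (by omega) hk).2 (Or.inl rfl)
    have hend : ∀ k, k < n → (k = 0 ∨ k = n - 1) → IsPathEndpoint G P (g k) := by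
      intro k hk h
      refine ⟨(g k).2, ?_⟩
      have hsub : {v | v ∈ P ∧ G.Adj (g k) v} ⊆ {((g (if k = 0 then 1 else k - 1) : P) : V)} := by
        rintro v ⟨hv, hav⟩
        obtain ⟨j, hj, hjv⟩ := hsur ⟨v, hv⟩
        have : (G.induce P).Adj (g k) (g j) := by rw [hjv]; exact hav
        rw [hadj k j hk hj] at this
        have hjj : j = if k = 0 then 1 else k - 1 := by split_ifs <;> omega
        rw [Set.mem_singleton_iff, ← hjj, hjv]
      calc _ ≤ _ := Set.ncard_le_ncard hsub (Set.finite_singleton _)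
        _ = 1 := Set.ncard_singleton _
        _ ≤ 1 := le_rfl
    constructor
    · have h1 := hA.2 (σ s) (hσ s) P hP (g i) (g i).2 hsi (g 0) (g 0).2 (hend 0 (by omega) (Or.inl rfl))
      obtain ⟨w, hw, _⟩ := walk_seg (G.induce P) g i 0 (fun k _ h2 => hstep k (by omega))
      have h2 := SimpleGraph.dist_le w
      rw [SimpleGraph.dist_comm, hw, Nat.zero_add] at h2
      exact h1.trans h2
    · have h1 := hA.2 (σ s) (hσ s) P hP (g i) (g i).2 hsi (g (n - 1)) (g (n - 1)).2
        (hend (n - 1) (by omega) (Or.inr rfl))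
      obtain ⟨w, hw, _⟩ := walk_seg (G.induce P) g (n - 1 - i) i (fun k _ h2 => hstep k (by omega))
      have h2 := SimpleGraph.dist_le w
      rw [hw, show i + (n - 1 - i) = n - 1 by omega] at h2
      have := h1.trans h2
      omega
  · rintro s t u i j ⟨h1, h2⟩ ⟨h3, h4⟩ hne hsu htu hij
    obtain ⟨p, hp, _, hm⟩ := hroute s t i j hne hij h1 h3 h2 h4
    have : ∃ v ∈ p.support, G.Adj (σ u) v := by
      rcases lt_or_gt_of_ne hne with h | h
      · exact hint s t u h htu p hp
      · obtain ⟨v, hv, hv'⟩ := hint t s u h hsu p.reverse (route_rev hp)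
        exact ⟨v, by simpa using hv, hv'⟩
    obtain ⟨v, hv, hv'⟩ := this
    have hind : ∀ a b, ¬ G.Adj (σ a) (σ b) := by
      intro a b hab
      exact hC.indep (hσ a) (hσ b) hab.ne hab
    rcases hm v hv with rfl | rfl | ⟨k, hk1, hk2, rfl⟩
    · exact absurd hv' (hind _ _)
    · exact absurd hv' (hind _ _)
    · have hkn : k < n := by omega
      have e1 := hfar s u i k ⟨h1, h2⟩ ⟨hkn, hv'⟩ hsu.ne hk1
      have e2 := hfar u t k j ⟨hkn, hv'⟩ ⟨h3, h4⟩ htu.ne' hk2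
      exact ⟨k, by omega, by omega, hkn, hv'⟩
  · intro s
    obtain ⟨v, hv, hav⟩ := hC.dominates (σ s) (hσ s) P hP
    obtain ⟨i, hi, hiv⟩ := hsur ⟨v, hv⟩
    exact ⟨i, hi, by rw [hiv]; exact hav⟩

theorem exists_sys (ℓ : ℕ)
    (V : Type) (G : SimpleGraph V) (SC : Set V) (LC : Set (Set V))
    (hC : IsConstellation G SC LC)
    (hsp : IsSPConst SC LC (2 * ℓ + 4) ((2 * ℓ + 3) * ℓ + 1))
    (hi : IsInterrupted G SC) (hA : IsAmpleStrong G SC LC (ℓ + 1)) :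
    ∃ σ g m, Sys G ℓ σ g m := by
  classical
  obtain ⟨hS1, hS2, hL1, hL2⟩ := hsp
  obtain ⟨r, hr, hint⟩ := hi
  obtain ⟨σ, hσi, hσ, _, hσr⟩ := exists_sigma SC _ hS1 hS2 r hr
  have : Finite LC := hL1
  have hcard : Nat.card (Option (Fin (2 * ℓ + 3) × Fin ℓ)) = Nat.card LC := by
    rw [Nat.card_coe_set_eq, hL2]; simp
  obtain ⟨e⟩ : Nonempty (Option (Fin (2 * ℓ + 3) × Fin ℓ) ≃ LC) := Finite.card_eq.1 hcard
  have hdat : ∀ a, ∃ (n : ℕ) (g : ℕ → (e a : Set V)), (∀ v, ∃ i < n, g i = v) ∧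
      (∀ i j, i < n → j < n → g i = g j → i = j) ∧
      (∀ i j, i < n → j < n → ((G.induce (e a : Set V)).Adj (g i) (g j) ↔ i + 1 = j ∨ j + 1 = i)) := by
    intro a
    have : Nonempty (e a : Set V) := (hC.pathsNonempty _ (e a).2).to_subtype
    exact path_data _ (hC.pathsArePaths _ (e a).2)
  choose m g h1 h2 h3 using hdat
  have hne : ∀ a b, a ≠ b → (e a : Set V) ≠ e b := fun a b hab h =>
    hab (e.injective (Subtype.ext h))
  refine ⟨σ, fun a i => (g a i : V), m, hσi, ?_, ?_, ?_, ?_, ?_⟩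
  · intro s t h
    exact hC.indep (hσ s) (hσ t) h.ne h
  · intro a b i j hi hj h
    by_cases hab : a = b
    · subst hab
      exact ⟨rfl, h2 a i j hi hj (Subtype.ext h)⟩
    · have := Set.disjoint_left.1 (hC.pathsDisj (e a).2 (e b).2 (hne a b hab)) (g a i).2
      exact absurd (by rw [h]; exact (g b j).2) this
  · intro a i s hi h
    exact Set.disjoint_left.1 (hC.pathsOffS _ (e a).2) (g a i).2 (h ▸ hσ s)
  · intro a b i j hi hj
    by_cases hab : a = b
    · subst hab
      have := h3 a i j hi hj
      rw [SimpleGraph.comap_adj] at this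
      simpa using this
    · have := hC.pathsSep _ (e a).2 _ (e b).2 (hne a b hab) _ (g a i).2 _ (g b j).2
      simp [this, hab]
  · intro a
    exact path_wd hC hA σ hσi hσ (fun s t u hst htu p hp =>
      hint _ (hσ s) _ (hσ t) _ (hσ u) (hσr s t hst) (hσr t u htu) p hp) _ (e a).2 _ (g a)
      (h1 a) (h2 a) (h3 a)

theorem statement13 (ℓ : ℕ) (hℓ : 2 ≤ ℓ)
    (V : Type) (G : SimpleGraph V) (SC : Set V) (LC : Set (Set V))
    (hC : IsConstellation G SC LC)
    (hsp : IsSPConst SC LC (2 * ℓ + 4) ((2 * ℓ + 3) * ℓ + 1))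
    (hi : IsInterrupted G SC) (hA : IsAmpleStrong G SC LC (ℓ + 1)) :
    InducedMinor (T2Union ℓ) G ∧ InducedMinor (T3Union ℓ) G := by
  obtain ⟨σ, g, m, D⟩ := exists_sys ℓ V G SC LC hC hsp hi hA
  obtain ⟨hs, Lab, C⟩ := core2' hℓ (D.wd none)
  obtain ⟨hs', Lab', C'⟩ := core3 hℓ (D.wd none)
  exact ⟨D.minor C (T2Union ℓ) (phiU ℓ) (phiU_inj ℓ) (phiU_val ℓ) (phi_union ℓ false),
    D.minor C' (T3Union ℓ) (phiU ℓ) (phiU_inj ℓ) (phiU_val ℓ) (phi_union ℓ true)⟩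

end Paper
end

section
/- For every integer n ≥ 2, the n × n Pohoata–Davies grid has girth exactly 6; in particular, it contains no K_{2,2} as a subgraph. -/
open SimpleGraph

namespace Paper

variable {V W : Type*}

theorem pd_ll {n : ℕ} (a b c d : Fin n) :
    (pdGrid n).Adj (Sum.inl (a, b)) (Sum.inl (c, d)) ↔
      a = c ∧ ((b : ℕ) + 1 = d ∨ (d : ℕ) + 1 = b) := by
  simp only [pdGrid, SimpleGraph.fromRel_adj, ne_eq, Sum.inl.injEq, Prod.mk.injEq, Fin.ext_iff]
  omega

theorem pd_lr {n : ℕ} (a b s : Fin n) :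
    (pdGrid n).Adj (Sum.inl (a, b)) (Sum.inr s) ↔ b = s := by
  simp [pdGrid, SimpleGraph.fromRel_adj]

theorem pd_rl {n : ℕ} (a b s : Fin n) :
    (pdGrid n).Adj (Sum.inr s) (Sum.inl (a, b)) ↔ b = s := by
  simp [pdGrid, SimpleGraph.fromRel_adj]

theorem pd_rr {n : ℕ} (s t : Fin n) :
    ¬ (pdGrid n).Adj (Sum.inr s) (Sum.inr t) := by
  simp [pdGrid, SimpleGraph.fromRel_adj]

theorem pd_no_c4 {n : ℕ} (a b c d : Fin n × Fin n ⊕ Fin n)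
    (h1 : (pdGrid n).Adj a b) (h2 : (pdGrid n).Adj b c) (h3 : (pdGrid n).Adj c d)
    (h4 : (pdGrid n).Adj d a) (hac : a ≠ c) (hbd : b ≠ d) : False := by
  rcases a with ⟨a, a'⟩ | a <;> rcases b with ⟨b, b'⟩ | b <;> rcases c with ⟨c, c'⟩ | c <;>
    rcases d with ⟨d, d'⟩ | d <;>
    simp only [pd_ll, pd_lr, pd_rl, pd_rr, ne_eq, Sum.inl.injEq, Sum.inr.injEq, Prod.mk.injEq,
      Fin.ext_iff] at * <;> omega

/-- The parity colouring of the grid. -/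
def pdCol {n : ℕ} : Fin n × Fin n ⊕ Fin n → ℕ
  | Sum.inl p => p.2
  | Sum.inr s => s + 1

theorem pdCol_adj {n : ℕ} (a b : Fin n × Fin n ⊕ Fin n) (h : (pdGrid n).Adj a b) :
    pdCol a % 2 ≠ pdCol b % 2 := by
  rcases a with ⟨a, a'⟩ | a <;> rcases b with ⟨b, b'⟩ | b <;>
    simp only [pd_ll, pd_lr, pd_rl, pd_rr, pdCol, Fin.ext_iff] at * <;> omega

theorem pd_cycle {n : ℕ} (a : Fin n × Fin n ⊕ Fin n) (w : (pdGrid n).Walk a a)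
    (hw : w.IsCycle) : 6 ≤ w.length := by
  by_contra hlt
  have h3 := hw.three_le_length
  have hadj : ∀ i < w.length, (pdGrid n).Adj (w.getVert i) (w.getVert (i + 1)) :=
    fun i hi => w.adj_getVert_succ hi
  have hcol := fun i hi => pdCol_adj _ _ (hadj i hi)
  have h0 : w.getVert 0 = a := w.getVert_zero
  have hl : w.getVert w.length = a := w.getVert_length
  have hinj := hw.getVert_injOn'
  have hc : w.length = 3 ∨ w.length = 4 ∨ w.length = 5 := by omega
  rcases hc with hc | hc | hc <;> rw [hc] at hl hadj hcol
  · have e0 := hcol 0 (by omega)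
    have e1 := hcol 1 (by omega)
    have e2 := hcol 2 (by omega)
    norm_num [h0, hl] at e0 e1 e2
    omega
  · refine pd_no_c4 _ _ _ _ (hadj 0 (by omega)) (hadj 1 (by omega)) (hadj 2 (by omega))
      (by have := hadj 3 (by omega); rw [h0]; rwa [hl] at this) ?_ ?_
    · intro h
      have := hinj (by simp) (by simp [hc]) h
      omega
    · intro h
      have := hinj (by simp [hc]) (by simp [hc]) h
      omega
  · have e0 := hcol 0 (by omega)
    have e1 := hcol 1 (by omega)
    have e2 := hcol 2 (by omega)
    have e3 := hcol 3 (by omega)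
    have e4 := hcol 4 (by omega)
    norm_num [h0, hl] at e0 e1 e2 e3 e4
    omega

theorem pd_has_c6 (n : ℕ) (hn : 2 ≤ n) :
    ∃ (a : _) (w : (pdGrid n).Walk a a), w.IsCycle ∧ w.length = 6 := by
  let z : Fin n := ⟨0, by omega⟩
  let o : Fin n := ⟨1, by omega⟩
  have hzo : z ≠ o := by simp [z, o]
  have h1 : (pdGrid n).Adj (Sum.inr z) (Sum.inl (z, z)) := by simp [pd_rl]
  have h2 : (pdGrid n).Adj (Sum.inl (z, z)) (Sum.inl (z, o)) := by simp [pd_ll, z, o]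
  have h3 : (pdGrid n).Adj (Sum.inl (z, o)) (Sum.inr o) := by simp [pd_lr]
  have h4 : (pdGrid n).Adj (Sum.inr o) (Sum.inl (o, o)) := by simp [pd_rl]
  have h5 : (pdGrid n).Adj (Sum.inl (o, o)) (Sum.inl (o, z)) := by simp [pd_ll, z, o]
  have h6 : (pdGrid n).Adj (Sum.inl (o, z)) (Sum.inr z) := by simp [pd_lr]
  refine ⟨_, .cons h1 (.cons h2 (.cons h3 (.cons h4 (.cons h5 (.cons h6 .nil))))), ?_, rfl⟩
  simp [SimpleGraph.Walk.cons_isCycle_iff, SimpleGraph.Walk.cons_isPath_iff, hzo, hzo.symm]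

theorem statement17 (n : ℕ) (hn : 2 ≤ n) :
    (pdGrid n).girth = 6 ∧ ¬ HasSubgraphCopy (pdGrid n) (Ktt 2) := by
  constructor
  · obtain ⟨a, w, hw, hl⟩ := pd_has_c6 n hn
    apply le_antisymm
    · rw [← hl]; exact SimpleGraph.girth_le_length hw
    · obtain ⟨b, u, hu, hul⟩ := SimpleGraph.exists_girth_eq_length.mpr
        (fun h : (pdGrid n).IsAcyclic => h w hw)
      rw [hul]; exact pd_cycle b u hu
  · rintro ⟨f, hf, h⟩
    refine pd_no_c4 (f (Sum.inl 0)) (f (Sum.inr 0)) (f (Sum.inl 1)) (f (Sum.inr 1))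
      (h _ _ ?_) (h _ _ ?_) (h _ _ ?_) (h _ _ ?_) (hf.ne ?_) (hf.ne ?_) <;> simp [Ktt]

end Paper
end

section
/- For every positive integer n, the death star of height n contains no K_{2,3} as a subgraph. -/
open SimpleGraph

namespace Paper

variable {V W : Type*}

theorem ds_star_aux (i p q : ℕ) (h : q + 1 ≤ p)
    (h1 : i % 2 ^ (p + 1) = 2 ^ p - 1) (h2 : i % 2 ^ (q + 1) = 2 ^ q - 1) : False := by
  have hp : 0 < 2 ^ p := by positivity
  have hq : 0 < 2 ^ q := by positivity
  have e1 : i + 1 = 2 ^ (p + 1) * (i / 2 ^ (p + 1)) + 2 ^ p := by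
    have := Nat.div_add_mod i (2 ^ (p + 1))
    omega
  have e2 : i + 1 = 2 ^ (q + 1) * (i / 2 ^ (q + 1)) + 2 ^ q := by
    have := Nat.div_add_mod i (2 ^ (q + 1))
    omega
  have d1 : 2 ^ (q + 1) ∣ i + 1 := by
    rw [e1]
    exact dvd_add (Dvd.dvd.mul_right (pow_dvd_pow 2 (by omega)) _) (pow_dvd_pow 2 h)
  rw [e2] at d1
  have d2 : 2 ^ (q + 1) ∣ 2 ^ q := (Nat.dvd_add_right (dvd_mul_right _ _)).1 d1
  have := Nat.le_of_dvd hq d2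
  rw [pow_succ] at this
  omega

theorem ds_star_unique (n i : ℕ) (k l : Fin n)
    (h1 : i % 2 ^ (n - (k : ℕ)) = 2 ^ (n - 1 - (k : ℕ)) - 1)
    (h2 : i % 2 ^ (n - (l : ℕ)) = 2 ^ (n - 1 - (l : ℕ)) - 1) : k = l := by
  have hk := k.isLt
  have hl := l.isLt
  have ek : n - (k : ℕ) = (n - 1 - (k : ℕ)) + 1 := by omega
  have el : n - (l : ℕ) = (n - 1 - (l : ℕ)) + 1 := by omega
  rw [ek] at h1
  rw [el] at h2
  by_contra hne
  have hne' : (k : ℕ) ≠ l := fun h => hne (Fin.ext h)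
  rcases lt_or_gt_of_ne hne' with h | h
  · exact ds_star_aux i _ _ (by omega) h1 h2
  · exact ds_star_aux i _ _ (by omega) h2 h1

theorem ds_pp {n : ℕ} {i j : Fin (2 ^ n - 1)}
    (h : (deathStar n).Adj (Sum.inl i) (Sum.inl j)) :
    (i : ℕ) + 1 = j ∨ (j : ℕ) + 1 = i := by
  simpa [deathStar] using h.2

theorem ds_ps {n : ℕ} {i : Fin (2 ^ n - 1)} {k : Fin n}
    (h : (deathStar n).Adj (Sum.inl i) (Sum.inr k)) :
    (i : ℕ) % 2 ^ (n - (k : ℕ)) = 2 ^ (n - 1 - (k : ℕ)) - 1 := by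
  simpa [deathStar] using h.2

theorem ds_ss {n : ℕ} {k l : Fin n}
    (h : (deathStar n).Adj (Sum.inr k) (Sum.inr l)) : False := by
  simpa [deathStar] using h.2

theorem ds_uniq {n : ℕ} {i : Fin (2 ^ n - 1)} {k l : Fin n}
    (h : (deathStar n).Adj (Sum.inl i) (Sum.inr k))
    (h' : (deathStar n).Adj (Sum.inl i) (Sum.inr l)) : k = l :=
  ds_star_unique n i k l (ds_ps h) (ds_ps h')

/-- A star vertex and a path vertex have at most two common neighbours. -/
theorem ds_mixed {n : ℕ} {k : Fin n} {b : Fin (2 ^ n - 1)} {x y z : Fin (2 ^ n - 1) ⊕ Fin n}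
    (hxy : x ≠ y) (hxz : x ≠ z) (hyz : y ≠ z)
    (ax : (deathStar n).Adj (Sum.inr k) x) (ay : (deathStar n).Adj (Sum.inr k) y)
    (az : (deathStar n).Adj (Sum.inr k) z)
    (bx : (deathStar n).Adj (Sum.inl b) x) (bY : (deathStar n).Adj (Sum.inl b) y)
    (bz : (deathStar n).Adj (Sum.inl b) z) : False := by
  rcases x with x | x
  swap
  · exact ds_ss ax
  rcases y with y | y
  swap
  · exact ds_ss ay
  rcases z with z | z
  swap
  · exact ds_ss az
  have h1 := ds_pp bx
  have h2 := ds_pp bY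
  have h3 := ds_pp bz
  simp only [ne_eq, Sum.inl.injEq, Fin.ext_iff] at hxy hxz hyz
  omega

theorem ds_no (n : ℕ) {a b x y z : Fin (2 ^ n - 1) ⊕ Fin n} (hab : a ≠ b)
    (hxy : x ≠ y) (hxz : x ≠ z) (hyz : y ≠ z)
    (ax : (deathStar n).Adj a x) (ay : (deathStar n).Adj a y) (az : (deathStar n).Adj a z)
    (bx : (deathStar n).Adj b x) (bY : (deathStar n).Adj b y) (bz : (deathStar n).Adj b z) :
    False := by
  rcases a with a | a <;> rcases b with b | b
  · have key : ∀ u v : Fin (2 ^ n - 1) ⊕ Fin n, (deathStar n).Adj (Sum.inl a) u →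
        (deathStar n).Adj (Sum.inl b) u → (deathStar n).Adj (Sum.inl a) v →
        (deathStar n).Adj (Sum.inl b) v → u ≠ v → u.isLeft ≠ v.isLeft := by
      intro u v au bu av bv huv
      rcases u with u | u <;> rcases v with v | v
      · have h1 := ds_pp au
        have h2 := ds_pp bu
        have h3 := ds_pp av
        have h4 := ds_pp bv
        simp only [ne_eq, Sum.inl.injEq, Fin.ext_iff] at huv hab
        omega
      · simp
      · simp
      · exact absurd (congrArg Sum.inr (ds_uniq au av)) huv
    have k1 := key x y ax bx ay bY hxy
    have k2 := key x z ax bx az bz hxz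
    have k3 := key y z ay bY az bz hyz
    revert k1 k2 k3
    cases x.isLeft <;> cases y.isLeft <;> cases z.isLeft <;> simp
  · exact ds_mixed hxy hxz hyz bx bY bz ax ay az
  · exact ds_mixed hxy hxz hyz ax ay az bx bY bz
  · rcases x with x | x
    · exact hab (congrArg Sum.inr (ds_uniq ax.symm bx.symm))
    · exact ds_ss ax

theorem statement18 (n : ℕ) (hn : 1 ≤ n) :
    ¬ HasSubgraphCopy (deathStar n) (completeBipartiteGraph (Fin 2) (Fin 3)) := by
  rintro ⟨f, hf, h⟩
  have A : ∀ (i : Fin 2) (j : Fin 3), (deathStar n).Adj (f (Sum.inl i)) (f (Sum.inr j)) :=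
    fun i j => h _ _ (by simp)
  exact ds_no n (a := f (Sum.inl 0)) (b := f (Sum.inl 1)) (x := f (Sum.inr 0))
    (y := f (Sum.inr 1)) (z := f (Sum.inr 2))
    (hf.ne (by simp)) (hf.ne (by simp)) (hf.ne (by simp)) (hf.ne (by simp))
    (A _ _) (A _ _) (A _ _) (A _ _) (A _ _) (A _ _)

end Paper
end
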